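/- arXiv:2404.06327 — 4 statements merged into one kernel-verified Lean document; each statement's English description precedes it below -/
import Mathlib

section
/- There exist absolute constants K > 0 and c > 0 such that the following holds. Let A be an additive Abelian group, let ℓ, r ≥ 1, and let P : {0,1}^r → {0,1} be such that there is a degree-ℓ polynomial Q over A with: for all x ∈ {0,1}^r, P(x) = 1 if and only if Q(x) ≠ 0. Then for every ε ∈ (0,1), every n ≥ 1, and every instance Φ of CSP(P) on n variables, Φ admits an (ε, s)-sparsifier with s ≤ K·n^ℓ·r^{4ℓ}·(ℓ·log₂(2nr/ε))^c / ε². -/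
/-- The value of a CSP instance (with predicate `P`, weights `w`, and constraint
tuples `t`) on an assignment `a`. -/
noncomputable def cspVal {n r m : ℕ} (P : (Fin r → Bool) → Bool) (w : Fin m → ℝ)
    (t : Fin m → Fin r → Fin n) (a : Fin n → Bool) : ℝ :=
  ∑ j : Fin m, w j * (if P (fun k => a (t j k)) then 1 else 0)

/-- The value of a reweighted sub-instance, retaining only the constraints in `S`
with new weights `w`. -/
noncomputable def cspValOn {n r m : ℕ} (P : (Fin r → Bool) → Bool) (S : Finset (Fin m))
    (w : Fin m → ℝ) (t : Fin m → Fin r → Fin n) (a : Fin n → Bool) : ℝ :=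
  ∑ j ∈ S, w j * (if P (fun k => a (t j k)) then 1 else 0)

/-- `HasChain k 𝒞` says that there are coordinates `j₁, …, jₖ` and sets `s₁, …, sₖ ∈ 𝒞` such that
`jᵢ ∈ sᵢ` and `sᵢ` avoids all the earlier coordinates. -/
def HasChain {ι : Type*} [DecidableEq ι] : ℕ → Finset (Finset ι) → Prop
  | 0, _ => True
  | k + 1, 𝒞 => ∃ j, (∃ s ∈ 𝒞, j ∈ s) ∧ HasChain k (𝒞.filter (fun s => j ∉ s))

section ChainRank

variable {ι : Type*} [DecidableEq ι] {𝒞 𝒟 : Finset (Finset ι)}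

theorem HasChain.mono {k : ℕ} (h : 𝒞 ⊆ 𝒟) (hc : HasChain k 𝒞) : HasChain k 𝒟 := by
  induction k generalizing 𝒞 𝒟 with
  | zero => trivial
  | succ k ih =>
    obtain ⟨j, ⟨s, hs, hj⟩, hk⟩ := hc
    exact ⟨j, ⟨s, h hs, hj⟩, ih (Finset.filter_subset_filter _ h) hk⟩

theorem HasChain.le_card {k : ℕ} {U : Finset ι} (hU : ∀ s ∈ 𝒞, s ⊆ U) (hc : HasChain k 𝒞) :
    k ≤ U.card := by
  induction k generalizing 𝒞 U with
  | zero => exact Nat.zero_le _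
  | succ k ih =>
    obtain ⟨j, ⟨s, hs, hj⟩, hk⟩ := hc
    have hjU : j ∈ U := hU s hs hj
    have := ih (U := U.erase j) (fun s hs x hx => by
      simp only [Finset.mem_filter] at hs
      exact Finset.mem_erase.2 ⟨fun h => hs.2 (h ▸ hx), hU s hs.1 hx⟩) hk
    rw [Finset.card_erase_of_mem hjU] at this
    have := Finset.card_pos.2 ⟨j, hjU⟩
    omega

theorem HasChain.add {a b : ℕ} {T : Finset ι} (ha : HasChain a (𝒞.image (fun s => s \ T)))
    (hb : HasChain b (𝒞.filter (fun s => s ⊆ T))) : HasChain (a + b) 𝒞 := by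
  induction a generalizing 𝒞 with
  | zero => rw [Nat.zero_add]; exact hb.mono (Finset.filter_subset _ _)
  | succ a ih =>
    obtain ⟨j, ⟨s', hs', hj⟩, hk⟩ := ha
    obtain ⟨s, hs, rfl⟩ := Finset.mem_image.1 hs'
    obtain ⟨hjs, hjT⟩ := Finset.mem_sdiff.1 hj
    rw [Nat.add_right_comm]
    refine ⟨j, ⟨s, hs, hjs⟩, ih (hk.mono ?_) (hb.mono ?_)⟩
    · intro u hu
      simp only [Finset.mem_filter, Finset.mem_image] at hu ⊢
      obtain ⟨⟨v, hv, rfl⟩, hju⟩ := hu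
      exact ⟨v, ⟨hv, fun h => hju (Finset.mem_sdiff.2 ⟨h, hjT⟩)⟩, rfl⟩
    · intro u hu
      simp only [Finset.mem_filter] at hu ⊢
      exact ⟨⟨hu.1, fun h => hjT (hu.2 h)⟩, hu.2⟩

open Classical in
/-- The chain length of a set family. -/
noncomputable def chainRank (𝒞 : Finset (Finset ι)) : ℕ :=
  Nat.findGreatest (fun k => HasChain k 𝒞) (𝒞.sup id).card

theorem hasChain_chainRank (𝒞 : Finset (Finset ι)) : HasChain (chainRank 𝒞) 𝒞 := by
  classical
  exact Nat.findGreatest_spec (P := fun k => HasChain k 𝒞) (Nat.zero_le _) trivial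

theorem subset_sup_id {s : Finset ι} (hs : s ∈ 𝒞) : s ⊆ 𝒞.sup id :=
  Finset.le_sup (f := id) hs

theorem HasChain.le_chainRank {k : ℕ} (h : HasChain k 𝒞) : k ≤ chainRank 𝒞 := by
  classical
  exact Nat.le_findGreatest (h.le_card fun s hs => subset_sup_id hs) h

theorem chainRank_mono (h : 𝒞 ⊆ 𝒟) : chainRank 𝒞 ≤ chainRank 𝒟 :=
  ((hasChain_chainRank 𝒞).mono h).le_chainRank

theorem chainRank_le_card {U : Finset ι} (hU : ∀ s ∈ 𝒞, s ⊆ U) : chainRank 𝒞 ≤ U.card :=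
  (hasChain_chainRank 𝒞).le_card hU

theorem chainRank_image_add_filter_le (𝒞 : Finset (Finset ι)) (T : Finset ι) :
    chainRank (𝒞.image (fun s => s \ T)) + chainRank (𝒞.filter (fun s => s ⊆ T)) ≤ chainRank 𝒞 :=
  ((hasChain_chainRank _).add (hasChain_chainRank _)).le_chainRank

theorem chainRank_filter_notMem_lt {s : Finset ι} {j : ι} (hs : s ∈ 𝒞) (hj : j ∈ s) :
    chainRank (𝒞.filter (fun s => j ∉ s)) + 1 ≤ chainRank 𝒞 :=
  HasChain.le_chainRank ⟨j, ⟨s, hs, hj⟩, hasChain_chainRank _⟩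

theorem one_le_chainRank {s : Finset ι} {j : ι} (hs : s ∈ 𝒞) (hj : j ∈ s) : 1 ≤ chainRank 𝒞 :=
  le_trans (Nat.le_add_left _ _) (chainRank_filter_notMem_lt hs hj)

theorem one_le_chainRank_filter_subset {s : Finset ι} {j : ι} (hs : s ∈ 𝒞) (hj : j ∈ s) :
    1 ≤ chainRank (𝒞.filter (fun u => u ⊆ s)) :=
  one_le_chainRank (Finset.mem_filter.2 ⟨hs, subset_rfl⟩) hj

theorem card_le_pow_of_chainRank_le {U : Finset ι} {D : ℕ} (hU : ∀ s ∈ 𝒞, s ⊆ U)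
    (hD : chainRank 𝒞 ≤ D) : 𝒞.card ≤ (U.card + 1) ^ D := by
  induction D generalizing 𝒞 with
  | zero =>
    rw [pow_zero, Finset.card_le_one]
    have : ∀ s ∈ 𝒞, s = ∅ := fun s hs => by
      by_contra hne
      obtain ⟨j, hj⟩ := Finset.nonempty_iff_ne_empty.2 hne
      have := one_le_chainRank hs hj
      omega
    intro a ha b hb
    rw [this a ha, this b hb]
  | succ D ih =>
    set V := 𝒞.sup id
    have hVU : V ⊆ U := Finset.sup_le hU
    have hcover : 𝒞 ⊆ {V} ∪ V.biUnion (fun j => 𝒞.filter (fun s => j ∉ s)) := by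
      intro s hs
      by_cases h : s = V
      · simp [h]
      · obtain ⟨j, hjV, hjs⟩ := Finset.exists_of_ssubset
          ((subset_sup_id hs).ssubset_of_ne h)
        exact Finset.mem_union_right _
          (Finset.mem_biUnion.2 ⟨j, hjV, Finset.mem_filter.2 ⟨hs, hjs⟩⟩)
    have hj : ∀ j ∈ V, (𝒞.filter (fun s => j ∉ s)).card ≤ (U.card + 1) ^ D := by
      intro j hj
      obtain ⟨s, hs, hjs⟩ := Finset.mem_sup.1 hj
      have h1 := chainRank_filter_notMem_lt hs hjs
      exact ih (fun s hs => hU s (Finset.mem_filter.1 hs).1) (by omega)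
    calc 𝒞.card ≤ _ := Finset.card_le_card hcover
      _ ≤ 1 + V.card * (U.card + 1) ^ D := by
        refine (Finset.card_union_le _ _).trans ?_
        gcongr
        · simp
        · exact Finset.card_biUnion_le_card_mul _ _ _ hj
      _ ≤ (U.card + 1) ^ D + U.card * (U.card + 1) ^ D := by
        gcongr
        exact Nat.one_le_pow _ _ (Nat.succ_pos _)
      _ = (U.card + 1) ^ (D + 1) := by ring

/-- Karger-type counting: if every subfamily supported on `T` has chain length at most `w(T) / d`,
then few members have weight at most `α * d`. -/
theorem card_filter_weight_le {U : Finset ι} {w : ι → ℝ} {d : ℝ} (hd : 0 < d)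
    (hw : ∀ j, j ∈ U → 0 ≤ w j) {α D : ℕ} (hαD : α ≤ D) (hU : ∀ s ∈ 𝒞, s ⊆ U)
    (hdens : ∀ T ⊆ U, d * chainRank (𝒞.filter (fun s => s ⊆ T)) ≤ ∑ j ∈ T, w j)
    (hD : chainRank 𝒞 ≤ D) :
    (𝒞.filter (fun s => ∑ j ∈ s, w j ≤ α * d)).card ≤ D.choose α * (U.card + 1) ^ α := by
  induction D, hαD using Nat.le_induction generalizing 𝒞 with
  | base =>
    rw [Nat.choose_self, one_mul]
    exact (Finset.card_filter_le _ _).trans (card_le_pow_of_chainRank_le hU hD)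
  | succ D hαD ih =>
    rcases Nat.lt_or_ge D (chainRank 𝒞) with hlt | hle
    swap
    · refine (ih hU hdens hle).trans ?_
      gcongr
      exact Nat.le_succ D
    have hDeq : chainRank 𝒞 = D + 1 := by omega
    set F := D.choose α * (U.card + 1) ^ α with hF
    set L := 𝒞.filter (fun s => ∑ j ∈ s, w j ≤ α * d)
    set V := 𝒞.sup id
    have hVU : V ⊆ U := Finset.sup_le hU
    have hWV : d * (D + 1) ≤ ∑ j ∈ V, w j := by
      have h := hdens V hVU
      rw [Finset.filter_true_of_mem (fun s hs => subset_sup_id hs), hDeq] at h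
      exact_mod_cast h
    have hj : ∀ j ∈ V, ((L.filter (fun s => j ∉ s)).card : ℝ) ≤ F := by
      intro j hj
      obtain ⟨s, hs, hjs⟩ := Finset.mem_sup.1 hj
      have h1 := chainRank_filter_notMem_lt hs hjs
      rw [Finset.filter_comm]
      refine Nat.cast_le.2 (ih (fun s hs => hU s (Finset.mem_filter.1 hs).1) ?_ (by omega))
      intro T hT
      refine le_trans ?_ (hdens T hT)
      gcongr
      exact chainRank_mono (Finset.filter_subset_filter _ (Finset.filter_subset _ _))
    have hdouble : ∑ j ∈ V, w j * ((L.filter (fun s => j ∉ s)).card : ℝ)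
        = ∑ s ∈ L, (∑ j ∈ V, w j - ∑ j ∈ s, w j) := by
      have h1 : ∀ s ∈ L, (∑ j ∈ V, w j - ∑ j ∈ s, w j) = ∑ j ∈ V, if j ∉ s then w j else 0 := by
        intro s hs
        rw [← Finset.sum_sdiff (subset_sup_id (Finset.mem_filter.1 hs).1), add_sub_cancel_right,
          ← Finset.sum_filter]
        congr 1
        ext j
        simp [V]
      rw [Finset.sum_congr rfl h1, Finset.sum_comm]
      refine Finset.sum_congr rfl fun j _ => ?_
      rw [← Finset.sum_filter, Finset.sum_const, nsmul_eq_mul, mul_comm]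
    set W := ∑ j ∈ V, w j
    have hlow : (L.card : ℝ) * (W - α * d) ≤ ∑ s ∈ L, (W - ∑ j ∈ s, w j) := by
      rw [← nsmul_eq_mul]
      refine Finset.card_nsmul_le_sum _ _ _ fun s hs => ?_
      linarith [(Finset.mem_filter.1 hs).2]
    have hup : ∑ j ∈ V, w j * ((L.filter (fun s => j ∉ s)).card : ℝ) ≤ W * F := by
      rw [Finset.sum_mul]
      exact Finset.sum_le_sum fun j hjV => mul_le_mul_of_nonneg_left (hj j hjV) (hw j (hVU hjV))
    have hα : (α : ℝ) ≤ D := Nat.cast_le.2 hαD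
    have hkey : (L.card : ℝ) * (W - α * d) ≤ W * F := by linarith [hdouble]
    have hWpos : 0 < W := lt_of_lt_of_le (by positivity) hWV
    have hfin : (L.card : ℝ) * (D + 1 - α) ≤ (D + 1) * F := by
      have h2 : (L.card : ℝ) * (W * (D + 1 - α)) ≤ W * ((D + 1) * F) := by
        have h3 : W * (D + 1 - α) ≤ (W - α * d) * (D + 1) := by nlinarith [Nat.cast_nonneg (α := ℝ) α]
        calc (L.card : ℝ) * (W * (D + 1 - α)) ≤ L.card * ((W - α * d) * (D + 1)) := by gcongr
          _ = (L.card * (W - α * d)) * (D + 1) := by ring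
          _ ≤ (W * F) * (D + 1) := by gcongr
          _ = _ := by ring
      refine le_of_mul_le_mul_left ?_ hWpos
      linarith
    have hnat : L.card * (D + 1 - α) ≤ (D + 1).choose α * (U.card + 1) ^ α * (D + 1 - α) := by
      have h4 := Nat.choose_mul_succ_eq D α
      have : (D + 1).choose α * (U.card + 1) ^ α * (D + 1 - α) = (D + 1) * F := by
        rw [mul_right_comm, ← h4, hF]
        ring
      rw [this]
      have h5 : ((D + 1 - α : ℕ) : ℝ) = D + 1 - α := by
        rw [Nat.cast_sub (by omega)]; push_cast; ring
      have : ((L.card * (D + 1 - α) : ℕ) : ℝ) ≤ (((D + 1) * F : ℕ) : ℝ) := by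
        rw [Nat.cast_mul, h5]; push_cast at hfin ⊢; exact hfin
      exact_mod_cast this
    exact Nat.le_of_mul_le_mul_right hnat (by omega)

/-- Strengths: every coordinate `j` gets a strength `κ j` so that the coordinates of strength at
least `d` span a family of density at least `d`, while `∑ w / κ` is at most the chain length. -/
theorem exists_strength {J : Finset ι} {w : ι → ℝ} (hw : ∀ j ∈ J, 0 < w j)
    (hJ : ∀ s ∈ 𝒞, s ⊆ J) (hcov : ∀ j ∈ J, ∃ s ∈ 𝒞, j ∈ s) :
    ∃ κ : ι → ℝ, (∀ j ∈ J, 0 < κ j) ∧ ∑ j ∈ J, w j / κ j ≤ chainRank 𝒞 ∧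
      ∀ d : ℝ, 0 < d → ∀ T ⊆ J.filter (fun j => d ≤ κ j),
        d * chainRank ((𝒞.image (fun s => s ∩ J.filter (fun j => d ≤ κ j))).filter
          (fun s => s ⊆ T)) ≤ ∑ j ∈ T, w j := by
  induction J using Finset.strongInduction generalizing 𝒞 with
  | H J ih =>
    have hrk0 : ∀ (𝒟 : Finset (Finset ι)), chainRank (𝒟.filter (fun s => s ⊆ ∅)) = 0 :=
      fun 𝒟 => Nat.le_zero.1 (chainRank_le_card (U := ∅) fun s hs => (Finset.mem_filter.1 hs).2)
    rcases J.eq_empty_or_nonempty with rfl | ⟨j₀, hj₀⟩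
    · refine ⟨fun _ => 1, by simp, by simp, fun d _ T hT => ?_⟩
      obtain rfl : T = ∅ := by simpa using hT
      rw [hrk0]
      simp
    set cand := J.powerset.filter (fun T => 1 ≤ chainRank (𝒞.filter (fun s => s ⊆ T))) with hcand
    have hne : cand.Nonempty := by
      refine ⟨J, Finset.mem_filter.2 ⟨Finset.mem_powerset_self J, ?_⟩⟩
      obtain ⟨s, hs, hjs⟩ := hcov j₀ hj₀
      exact one_le_chainRank (Finset.mem_filter.2 ⟨hs, hJ s hs⟩) hjs
    obtain ⟨T₁, hT₁, hmin⟩ := Finset.exists_min_image cand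
      (fun T => (∑ j ∈ T, w j) / (chainRank (𝒞.filter (fun s => s ⊆ T)) : ℝ)) hne
    obtain ⟨hT₁J, hT₁rk⟩ := Finset.mem_filter.1 hT₁
    rw [Finset.mem_powerset] at hT₁J
    have hT₁ne : T₁.Nonempty := by
      rw [Finset.nonempty_iff_ne_empty]
      rintro rfl
      rw [hrk0] at hT₁rk
      omega
    set ρ₁ : ℝ := (chainRank (𝒞.filter (fun s => s ⊆ T₁)) : ℝ) with hρ₁
    have hρ₁pos : 0 < ρ₁ := by rw [hρ₁]; exact_mod_cast hT₁rk
    have hwT₁ : 0 < ∑ j ∈ T₁, w j := Finset.sum_pos (fun j hj => hw j (hT₁J hj)) hT₁ne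
    set d₁ := (∑ j ∈ T₁, w j) / ρ₁ with hd₁
    have hd₁pos : 0 < d₁ := by positivity
    set 𝒞' := 𝒞.image (fun s => s \ T₁) with h𝒞'
    obtain ⟨κ', hκ'pos, hκ'sum, hκ'd⟩ := ih (J \ T₁)
      (Finset.sdiff_ssubset hT₁J hT₁ne) (𝒞 := 𝒞')
      (fun j hj => hw j (Finset.sdiff_subset hj))
      (by
        intro s hs
        obtain ⟨u, hu, rfl⟩ := Finset.mem_image.1 hs
        exact Finset.sdiff_subset_sdiff (hJ u hu) subset_rfl)
      (by
        intro j hj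
        obtain ⟨hjJ, hjT⟩ := Finset.mem_sdiff.1 hj
        obtain ⟨s, hs, hjs⟩ := hcov j hjJ
        exact ⟨s \ T₁, Finset.mem_image_of_mem _ hs, Finset.mem_sdiff.2 ⟨hjs, hjT⟩⟩)
    set κ : ι → ℝ := fun j => if j ∈ T₁ then d₁ else max (κ' j) d₁ with hκ
    have hκge : ∀ j, d₁ ≤ κ j := fun j => by
      simp only [hκ]; split_ifs <;> simp
    refine ⟨κ, fun j _ => hd₁pos.trans_le (hκge j), ?_, ?_⟩
    · rw [← Finset.sum_sdiff hT₁J]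
      have h1 : ∑ j ∈ T₁, w j / κ j = ρ₁ := by
        rw [Finset.sum_congr rfl (g := fun j => w j / d₁) (fun j hj => by simp [hκ, hj]),
          ← Finset.sum_div, hd₁]
        field_simp
      have h2 : ∑ j ∈ J \ T₁, w j / κ j ≤ ∑ j ∈ J \ T₁, w j / κ' j := by
        refine Finset.sum_le_sum fun j hj => ?_
        have hjT := (Finset.mem_sdiff.1 hj).2
        have := hw j (Finset.mem_sdiff.1 hj).1
        simp only [hκ, if_neg hjT]
        exact div_le_div_of_nonneg_left this.le (hκ'pos j hj) (le_max_left _ _)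
      have h3 : ((chainRank 𝒞' : ℕ) : ℝ) + ρ₁ ≤ chainRank 𝒞 := by
        rw [hρ₁]
        exact_mod_cast chainRank_image_add_filter_le 𝒞 T₁
      linarith
    · intro d hd T hT
      rcases le_or_gt d d₁ with hle | hlt
      · have hF : J.filter (fun j => d ≤ κ j) = J :=
          Finset.filter_true_of_mem fun j _ => hle.trans (hκge j)
        rw [hF] at hT ⊢
        have himg : 𝒞.image (fun s => s ∩ J) = 𝒞 := by
          refine (Finset.image_congr fun s hs => ?_).trans Finset.image_id
          exact Finset.inter_eq_left.2 (hJ s hs)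
        rw [himg]
        rcases Nat.eq_zero_or_pos (chainRank (𝒞.filter (fun s => s ⊆ T))) with h0 | hpos
        · rw [h0]
          simpa using Finset.sum_nonneg fun j hj => (hw j (hT hj)).le
        · have h := hmin T (Finset.mem_filter.2 ⟨Finset.mem_powerset.2 hT, hpos⟩)
          have hpos' : (0 : ℝ) < chainRank (𝒞.filter (fun s => s ⊆ T)) := by exact_mod_cast hpos
          exact (le_div_iff₀ hpos').1 (hle.trans h)
      · have hF : J.filter (fun j => d ≤ κ j) = (J \ T₁).filter (fun j => d ≤ κ' j) := by
          ext j
          simp only [Finset.mem_filter, Finset.mem_sdiff, hκ]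
          by_cases hj : j ∈ T₁
          · simp [hj, hlt]
          · simp [hj, hlt.not_ge]
        rw [hF] at hT ⊢
        have himg : 𝒞'.image (fun s => s ∩ (J \ T₁).filter (fun j => d ≤ κ' j))
            = 𝒞.image (fun s => s ∩ (J \ T₁).filter (fun j => d ≤ κ' j)) := by
          rw [h𝒞', Finset.image_image]
          refine Finset.image_congr fun s _ => ?_
          ext j
          simp only [Function.comp, Finset.mem_inter, Finset.mem_sdiff, Finset.mem_filter]
          tauto
        rw [← himg]
        exact hκ'd d hd T hT

end ChainRank

section Signs

variable {ι : Type*} [Fintype ι] [DecidableEq ι]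

/-- The sign `±1` attached to a Boolean. -/
def boolSign (b : Bool) : ℝ := if b then 1 else -1

theorem boolSign_not (b : Bool) : boolSign (!b) = -boolSign b := by
  cases b <;> simp [boolSign]

theorem sum_exp_signs_le (s : Finset ι) (a : ι → ℝ) :
    ∑ σ : ι → Bool, Real.exp (∑ j ∈ s, a j * boolSign (σ j))
      ≤ 2 ^ Fintype.card ι * Real.exp ((∑ j ∈ s, a j ^ 2) / 2) := by
  have h1 : ∀ σ : ι → Bool, Real.exp (∑ j ∈ s, a j * boolSign (σ j))
      = ∏ j, Real.exp ((if j ∈ s then a j else 0) * boolSign (σ j)) := by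
    intro σ
    rw [← Real.exp_sum]
    simp [ite_mul, Finset.sum_ite_mem]
  have h2 := Finset.prod_univ_sum (fun _ : ι => (Finset.univ : Finset Bool))
    (fun j b => Real.exp ((if j ∈ s then a j else 0) * boolSign b))
  rw [Fintype.piFinset_univ] at h2
  simp_rw [h1]
  rw [← h2]
  calc ∏ j, ∑ b : Bool, Real.exp ((if j ∈ s then a j else 0) * boolSign b)
      ≤ ∏ j : ι, (2 * Real.exp ((if j ∈ s then a j else 0) ^ 2 / 2)) := by
        refine Finset.prod_le_prod (fun _ _ => by positivity) fun j _ => ?_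
        have := Real.cosh_le_exp_half_sq (if j ∈ s then a j else 0)
        rw [Real.cosh_eq] at this
        simp only [Fintype.sum_bool, boolSign]
        simp only [if_true, mul_one, mul_neg, Bool.false_eq_true, if_false]
        linarith
    _ = _ := by
        rw [Finset.prod_mul_distrib, Finset.prod_const, Finset.card_univ, ← Real.exp_sum,
          ← Finset.sum_div]
        simp [ite_pow, Finset.sum_ite_mem]

theorem card_signs_gt_le (s : Finset ι) (a : ι → ℝ) {V lam : ℝ} (hV : 0 < V) (hl : 0 ≤ lam)
    (h : ∑ j ∈ s, a j ^ 2 ≤ V) :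
    ((Finset.univ.filter (fun σ : ι → Bool => lam < ∑ j ∈ s, a j * boolSign (σ j))).card : ℝ)
      ≤ 2 ^ Fintype.card ι * Real.exp (-lam ^ 2 / (2 * V)) := by
  set t := lam / V with ht
  have ht0 : 0 ≤ t := by positivity
  set B := Finset.univ.filter (fun σ : ι → Bool => lam < ∑ j ∈ s, a j * boolSign (σ j))
  have h1 : (B.card : ℝ) * Real.exp (t * lam)
      ≤ ∑ σ : ι → Bool, Real.exp (∑ j ∈ s, (t * a j) * boolSign (σ j)) := by
    rw [← nsmul_eq_mul]
    refine (Finset.card_nsmul_le_sum B _ _ fun σ hσ => ?_).trans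
      (Finset.sum_le_sum_of_subset_of_nonneg (Finset.subset_univ B) fun _ _ _ => by positivity)
    refine Real.exp_le_exp.2 ?_
    simp_rw [mul_assoc]
    rw [← Finset.mul_sum]
    exact mul_le_mul_of_nonneg_left (Finset.mem_filter.1 hσ).2.le ht0
  have h2 := h1.trans (sum_exp_signs_le s _)
  have h3 : (∑ j ∈ s, (t * a j) ^ 2) / 2 ≤ t ^ 2 * V / 2 := by
    simp_rw [mul_pow]
    rw [← Finset.mul_sum]
    gcongr
  have h4 : (B.card : ℝ) ≤ 2 ^ Fintype.card ι * Real.exp (t ^ 2 * V / 2) / Real.exp (t * lam) := by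
    rw [le_div_iff₀ (Real.exp_pos _)]
    refine h2.trans ?_
    gcongr
  rw [mul_div_assoc, ← Real.exp_sub] at h4
  refine h4.trans (le_of_eq ?_)
  congr 2
  rw [ht]
  field_simp
  ring

theorem card_signs_abs_gt_le (s : Finset ι) (a : ι → ℝ) {V lam : ℝ} (hV : 0 < V) (hl : 0 ≤ lam)
    (h : ∑ j ∈ s, a j ^ 2 ≤ V) :
    ((Finset.univ.filter (fun σ : ι → Bool => lam < |∑ j ∈ s, a j * boolSign (σ j)|)).card : ℝ)
      ≤ 2 ^ Fintype.card ι * (2 * Real.exp (-lam ^ 2 / (2 * V))) := by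
  have h1 := card_signs_gt_le s a hV hl h
  have h2 := card_signs_gt_le s (fun j => -a j) hV hl (by simpa using h)
  have h3 : Finset.univ.filter (fun σ : ι → Bool => lam < |∑ j ∈ s, a j * boolSign (σ j)|)
      ⊆ Finset.univ.filter (fun σ : ι → Bool => lam < ∑ j ∈ s, a j * boolSign (σ j))
        ∪ Finset.univ.filter (fun σ : ι → Bool => lam < ∑ j ∈ s, -a j * boolSign (σ j)) := by
    intro σ hσ
    simp only [Finset.mem_union, Finset.mem_filter, Finset.mem_univ, true_and, neg_mul,
      Finset.sum_neg_distrib] at hσ ⊢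
    exact lt_abs.1 hσ
  have h4 : ((Finset.univ.filter
      (fun σ : ι → Bool => lam < |∑ j ∈ s, a j * boolSign (σ j)|)).card : ℝ) ≤ _ :=
    Nat.cast_le.2 ((Finset.card_le_card h3).trans (Finset.card_union_le _ _))
  push_cast at h4
  linarith

theorem sum_pow_succ_range_le {x : ℝ} (hx0 : 0 ≤ x) (hx : x ≤ 1 / 2) (N : ℕ) :
    ∑ k ∈ Finset.range N, x ^ (k + 1) ≤ 2 * x := by
  have h1 : ∑ k ∈ Finset.range N, x ^ k ≤ 2 := by
    refine (Summable.sum_le_tsum _ (fun k _ => by positivity)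
      (summable_geometric_of_lt_one hx0 (by linarith))).trans ?_
    rw [tsum_geometric_of_lt_one hx0 (by linarith), inv_le_comm₀ (by linarith) (by norm_num)]
    linarith
  simp_rw [pow_succ]
  rw [← Finset.sum_mul]
  nlinarith

theorem card_bad_signs_le {𝒟 : Finset (Finset ι)} {F B : Finset ι} {w : ι → ℝ} {d ρ η : ℝ} {m : ℕ}
    (hF : ∀ s ∈ 𝒟, s ⊆ F) (hw : ∀ j ∈ F, 0 < w j) (hd : 0 < d) (hρ : 0 < ρ) (hη : 0 < η)
    (hdens : ∀ T ⊆ F, d * chainRank (𝒟.filter (fun s => s ⊆ T)) ≤ ∑ j ∈ T, w j)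
    (hB : ∀ j ∈ B, w j ≤ 2 * d / ρ) (hm : F.card ≤ m)
    (hθ : Real.exp (-(η ^ 2 * ρ / 8)) ≤ 1 / (8 * ((m : ℝ) + 1) ^ 3)) :
    ((Finset.univ.filter (fun σ : ι → Bool => ∃ s ∈ 𝒟,
      η * ∑ j ∈ s, w j < |∑ j ∈ s ∩ B, w j * boolSign (σ j)|)).card : ℝ)
      ≤ 2 ^ Fintype.card ι * (1 / (2 * ((m : ℝ) + 1))) := by
  set 𝒟' := 𝒟.filter (fun s => s.Nonempty) with h𝒟'
  set θ := Real.exp (-(η ^ 2 * ρ / 8)) with hθdef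
  have hθ0 : 0 < θ := Real.exp_pos _
  set rk : Finset ι → ℕ := fun s => ⌈(∑ j ∈ s, w j) / d⌉₊ with hrk
  set bad : Finset ι → Finset (ι → Bool) := fun s => Finset.univ.filter (fun σ : ι → Bool =>
      η * ∑ j ∈ s, w j < |∑ j ∈ s ∩ B, w j * boolSign (σ j)|) with hbad
  have hwge : ∀ s ∈ 𝒟', d ≤ ∑ j ∈ s, w j := by
    intro s hs
    obtain ⟨hs, j, hj⟩ := Finset.mem_filter.1 hs
    have h1 : (1 : ℝ) ≤ chainRank (𝒟.filter (fun u => u ⊆ s)) :=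
      Nat.one_le_cast.2 (one_le_chainRank_filter_subset hs hj)
    nlinarith [hdens s (hF s hs)]
  have hbadcard : ∀ s ∈ 𝒟', ((bad s).card : ℝ) ≤ 2 ^ Fintype.card ι * (2 * θ ^ rk s) := by
    intro s hs
    have hsF := hF s (Finset.mem_filter.1 hs).1
    set W := ∑ j ∈ s, w j with hW
    have hWd : d ≤ W := hwge s hs
    have hWpos : 0 < W := hd.trans_le hWd
    have hV : ∑ j ∈ s ∩ B, w j ^ 2 ≤ 2 * d / ρ * W := by
      calc ∑ j ∈ s ∩ B, w j ^ 2 ≤ ∑ j ∈ s ∩ B, 2 * d / ρ * w j := by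
            refine Finset.sum_le_sum fun j hj => ?_
            obtain ⟨hjs, hjB⟩ := Finset.mem_inter.1 hj
            rw [pow_two]
            exact mul_le_mul_of_nonneg_right (hB j hjB) (hw j (hsF hjs)).le
        _ ≤ 2 * d / ρ * W := by
            rw [← Finset.mul_sum]
            refine mul_le_mul_of_nonneg_left ?_ (by positivity)
            exact Finset.sum_le_sum_of_subset_of_nonneg Finset.inter_subset_left
              fun j hj _ => (hw j (hsF hj)).le
    refine (card_signs_abs_gt_le (s ∩ B) w (lam := η * W) (by positivity) (by positivity)
      hV).trans ?_
    gcongr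
    rw [hθdef, ← Real.exp_nat_mul]
    refine Real.exp_le_exp.2 ?_
    have h1 : -(η * W) ^ 2 / (2 * (2 * d / ρ * W)) = -(η ^ 2 * ρ / 8) * (2 * (W / d)) := by
      field_simp
      ring
    rw [h1, mul_comm (rk s : ℝ)]
    refine mul_le_mul_of_nonpos_left ?_ (by simp only [Left.neg_nonpos_iff]; positivity)
    have h2 : (1 : ℝ) ≤ W / d := (one_le_div hd).2 hWd
    have h3 : (rk s : ℝ) < W / d + 1 := Nat.ceil_lt_add_one (by positivity)
    linarith
  have hcount : ∀ α : ℕ, ((𝒟'.filter (fun s => rk s = α)).card : ℝ) ≤ ((m : ℝ) + 1) ^ (2 * α) := by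
    intro α
    have hsub : 𝒟'.filter (fun s => rk s = α) ⊆ 𝒟.filter (fun s => ∑ j ∈ s, w j ≤ α * d) := by
      intro s hs
      simp only [h𝒟', Finset.mem_filter] at hs ⊢
      refine ⟨hs.1.1, ?_⟩
      rw [← div_le_iff₀ hd, ← hs.2]
      exact Nat.le_ceil _
    have h1 := card_filter_weight_le (𝒞 := 𝒟) hd (fun j hj => (hw j hj).le) (α := α)
      (le_max_right (chainRank 𝒟) α) hF hdens (le_max_left _ _)
    have h2 : (max (chainRank 𝒟) α).choose α ≤ (m + 1) ^ α := by
      rcases le_total (chainRank 𝒟) α with h | h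
      · rw [max_eq_right h, Nat.choose_self]
        exact Nat.one_le_pow _ _ (Nat.succ_pos _)
      · rw [max_eq_left h]
        refine (Nat.choose_le_pow _ _).trans (Nat.pow_le_pow_left ?_ _)
        exact ((chainRank_le_card hF).trans hm).trans (Nat.le_succ _)
    have h3 : (𝒟'.filter (fun s => rk s = α)).card ≤ (m + 1) ^ (2 * α) := by
      refine (Finset.card_le_card hsub).trans (h1.trans ?_)
      rw [two_mul, pow_add]
      gcongr
    exact_mod_cast h3
  have hsubset : Finset.univ.filter (fun σ : ι → Bool => ∃ s ∈ 𝒟,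
      η * ∑ j ∈ s, w j < |∑ j ∈ s ∩ B, w j * boolSign (σ j)|) ⊆ 𝒟'.biUnion bad := by
    intro σ hσ
    obtain ⟨s, hs, hlt⟩ := (Finset.mem_filter.1 hσ).2
    refine Finset.mem_biUnion.2 ⟨s, Finset.mem_filter.2 ⟨hs, ?_⟩, by simpa [hbad] using hlt⟩
    rw [Finset.nonempty_iff_ne_empty]
    rintro rfl
    simp at hlt
  set N := 𝒟'.sup rk
  set x : ℝ := 1 / (8 * ((m : ℝ) + 1)) with hx
  have hm0 : (0 : ℝ) ≤ m := Nat.cast_nonneg m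
  have hxle : x ≤ 1 / 2 := by
    rw [hx]
    gcongr
    linarith
  have hmx : ((m : ℝ) + 1) ^ 2 * θ ≤ x := by
    calc ((m : ℝ) + 1) ^ 2 * θ ≤ ((m : ℝ) + 1) ^ 2 * (1 / (8 * ((m : ℝ) + 1) ^ 3)) := by gcongr
      _ = x := by rw [hx]; field_simp
  have hmaps : ∀ s ∈ 𝒟', rk s ∈ (Finset.range N).image Nat.succ := by
    intro s hs
    have h1 : 0 < rk s := Nat.ceil_pos.2 (div_pos (hd.trans_le (hwge s hs)) hd)
    have h2 : rk s ≤ N := Finset.le_sup hs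
    exact Finset.mem_image.2 ⟨rk s - 1, Finset.mem_range.2 (by omega), by omega⟩
  calc _ ≤ (((𝒟'.biUnion bad).card : ℕ) : ℝ) := Nat.cast_le.2 (Finset.card_le_card hsubset)
    _ ≤ ∑ s ∈ 𝒟', ((bad s).card : ℝ) := by exact_mod_cast Finset.card_biUnion_le
    _ ≤ ∑ s ∈ 𝒟', 2 ^ Fintype.card ι * (2 * θ ^ rk s) := Finset.sum_le_sum hbadcard
    _ = 2 ^ Fintype.card ι * (2 * ∑ s ∈ 𝒟', θ ^ rk s) := by simp_rw [Finset.mul_sum]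
    _ ≤ 2 ^ Fintype.card ι * (2 * ∑ k ∈ Finset.range N, x ^ (k + 1)) := by
      gcongr
      rw [← Finset.sum_fiberwise_of_maps_to hmaps,
        Finset.sum_image (fun _ _ _ _ h => Nat.succ_injective h)]
      refine Finset.sum_le_sum fun k _ => ?_
      rw [Finset.sum_congr rfl (g := fun _ => θ ^ (k + 1))
        (fun s hs => by rw [(Finset.mem_filter.1 hs).2]), Finset.sum_const, nsmul_eq_mul]
      calc _ ≤ ((m : ℝ) + 1) ^ (2 * (k + 1)) * θ ^ (k + 1) := by
            gcongr
            exact hcount (k + 1)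
        _ = (((m : ℝ) + 1) ^ 2 * θ) ^ (k + 1) := by rw [mul_pow, pow_mul]
        _ ≤ x ^ (k + 1) := by gcongr
    _ ≤ 2 ^ Fintype.card ι * (2 * (2 * x)) := by
      gcongr
      exact sum_pow_succ_range_le (by positivity) hxle N
    _ = _ := by
      rw [hx]
      field_simp
      ring

/-- Given strengths `κ`, some choice of signs on the coordinates that are light relative to their
strength has small discrepancy on every member of the family. -/
theorem exists_signs_abs_sum_le {𝒞 : Finset (Finset ι)} {J : Finset ι} {w κ : ι → ℝ}
    {ρ δ : ℝ} {m L : ℕ}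
    (hJ : ∀ s ∈ 𝒞, s ⊆ J) (hw : ∀ j ∈ J, 0 < w j) (hκ : ∀ j ∈ J, 0 < κ j)
    (hdens : ∀ d : ℝ, 0 < d → ∀ T ⊆ J.filter (fun j => d ≤ κ j),
        d * chainRank ((𝒞.image (fun s => s ∩ J.filter (fun j => d ≤ κ j))).filter
          (fun s => s ⊆ T)) ≤ ∑ j ∈ T, w j)
    (hδ : 0 < δ) (hm : J.card ≤ m) (hL0 : 0 < L) (hL : m ≤ 2 ^ L) (hρδ : 4 / δ ≤ ρ)
    (hθ : Real.exp (-((δ / (2 * L)) ^ 2 * ρ / 8)) ≤ 1 / (8 * ((m : ℝ) + 1) ^ 3)) :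
    ∃ σ : ι → Bool, ∀ s ∈ 𝒞,
      |∑ j ∈ s ∩ J.filter (fun j => w j ≤ κ j / ρ), w j * boolSign (σ j)| ≤ δ * ∑ j ∈ s, w j := by
  have hρ : 0 < ρ := lt_of_lt_of_le (by positivity) hρδ
  have hL0' : (0 : ℝ) < L := by exact_mod_cast hL0
  set η := δ / (2 * L) with hη
  have hηpos : 0 < η := by positivity
  set lev : ι → ℤ := fun j => Int.log 2 (κ j) with hlev
  have hlev1 : ∀ j ∈ J, (2 : ℝ) ^ lev j ≤ κ j := fun j hj => by
    exact_mod_cast Int.zpow_log_le_self (b := 2) (by norm_num) (hκ j hj)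
  have hlev2 : ∀ j, κ j < 2 * (2 : ℝ) ^ lev j := fun j => by
    have := Int.lt_zpow_succ_log_self (b := 2) (by norm_num) (κ j)
    rw [zpow_add₀ (by norm_num), zpow_one, mul_comm] at this
    exact_mod_cast this
  set R := J.filter (fun j => w j ≤ κ j / ρ) with hR
  set B : ℤ → Finset ι := fun i => R.filter (fun j => lev j = i) with hB
  set F : ℤ → Finset ι := fun i => J.filter (fun j => (2 : ℝ) ^ i ≤ κ j) with hF
  set bad : ℤ → Finset (ι → Bool) := fun i => Finset.univ.filter (fun σ : ι → Bool =>
    ∃ s ∈ 𝒞.image (fun s => s ∩ F i),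
      η * ∑ j ∈ s, w j < |∑ j ∈ s ∩ B i, w j * boolSign (σ j)|) with hbad
  have hbadcard : ∀ i ∈ J.image lev,
      ((bad i).card : ℝ) ≤ 2 ^ Fintype.card ι * (1 / (2 * ((m : ℝ) + 1))) := by
    intro i _
    refine card_bad_signs_le (F := F i) (d := (2 : ℝ) ^ i) (ρ := ρ) ?_
      (fun j hj => hw j (Finset.mem_filter.1 hj).1) (by positivity) hρ hηpos
      (hdens _ (by positivity)) ?_ ((Finset.card_filter_le _ _).trans hm) hθ
    · intro s hs
      obtain ⟨u, _, rfl⟩ := Finset.mem_image.1 hs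
      exact Finset.inter_subset_right
    · intro j hj
      obtain ⟨hjR, rfl⟩ := Finset.mem_filter.1 hj
      refine (Finset.mem_filter.1 hjR).2.trans ?_
      gcongr
      exact (hlev2 j).le
  obtain ⟨σ, hσ⟩ : ∃ σ : ι → Bool, σ ∉ (J.image lev).biUnion bad := by
    by_contra! hall
    have h1 : ((Finset.univ : Finset (ι → Bool)).card : ℝ)
        ≤ ∑ i ∈ J.image lev, ((bad i).card : ℝ) := by
      have := (Finset.card_le_card (fun σ _ => hall σ :
        (Finset.univ : Finset (ι → Bool)) ⊆ _)).trans Finset.card_biUnion_le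
      exact_mod_cast this
    have h2 := h1.trans (Finset.sum_le_card_nsmul _ _ _ hbadcard)
    rw [Finset.card_univ, Fintype.card_fun, Fintype.card_bool, nsmul_eq_mul] at h2
    have h3 : ((J.image lev).card : ℝ) ≤ m := by
      exact_mod_cast Finset.card_image_le.trans hm
    have hm0 : (0 : ℝ) ≤ m := Nat.cast_nonneg m
    have h4 : ((J.image lev).card : ℝ) * (2 ^ Fintype.card ι * (1 / (2 * ((m : ℝ) + 1))))
        ≤ m * (2 ^ Fintype.card ι * (1 / (2 * ((m : ℝ) + 1)))) := by gcongr
    have h5 : (m : ℝ) * (2 ^ Fintype.card ι * (1 / (2 * ((m : ℝ) + 1))))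
        = 2 ^ Fintype.card ι * (m / (2 * ((m : ℝ) + 1))) := by ring
    have h6 : (m : ℝ) / (2 * ((m : ℝ) + 1)) < 1 := by
      rw [div_lt_one (by positivity)]
      linarith
    have h7 : (2 : ℝ) ^ Fintype.card ι * (m / (2 * ((m : ℝ) + 1))) < 2 ^ Fintype.card ι :=
      mul_lt_of_lt_one_right (by positivity) h6
    push_cast at h2
    linarith
  refine ⟨σ, fun s hs => ?_⟩
  have hsJ := hJ s hs
  have hws : ∀ j ∈ s, 0 < w j := fun j hj => hw j (hsJ hj)
  rcases s.eq_empty_or_nonempty with rfl | hsne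
  · simp
  have hlevel : ∀ i, |∑ j ∈ s ∩ B i, w j * boolSign (σ j)| ≤ η * ∑ j ∈ s, w j := by
    intro i
    have hnn : 0 ≤ ∑ j ∈ s, w j := Finset.sum_nonneg fun j hj => (hws j hj).le
    by_cases hi : i ∈ J.image lev
    · have h1 : σ ∉ bad i := fun h => hσ (Finset.mem_biUnion.2 ⟨i, hi, h⟩)
      simp only [hbad, Finset.mem_filter, Finset.mem_univ, true_and, not_exists, not_and,
        not_lt] at h1
      have h2 := h1 _ (Finset.mem_image_of_mem _ hs)
      have h3 : s ∩ F i ∩ B i = s ∩ B i := by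
        ext j
        simp only [hB, hF, hR, Finset.mem_inter, Finset.mem_filter]
        constructor
        · tauto
        · rintro ⟨hjs, ⟨hjJ, hjw⟩, rfl⟩
          exact ⟨⟨hjs, hjJ, hlev1 j hjJ⟩, ⟨hjJ, hjw⟩, rfl⟩
      rw [h3] at h2
      refine h2.trans (mul_le_mul_of_nonneg_left ?_ hηpos.le)
      exact Finset.sum_le_sum_of_subset_of_nonneg Finset.inter_subset_left
        fun j hj _ => (hws j hj).le
    · have h1 : s ∩ B i = ∅ := by
        ext j
        simp only [hB, hR, Finset.mem_inter, Finset.mem_filter, Finset.notMem_empty, iff_false]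
        rintro ⟨_, ⟨hjJ, _⟩, rfl⟩
        exact hi (Finset.mem_image_of_mem _ hjJ)
      rw [h1]
      simpa using mul_nonneg hηpos.le hnn
  obtain ⟨j₁, hj₁, hmax⟩ := Finset.exists_max_image s lev hsne
  set top := lev j₁
  set W := ∑ j ∈ s, w j with hW
  have hWtop : (2 : ℝ) ^ top ≤ W := by
    have hjF : j₁ ∈ s ∩ F top :=
      Finset.mem_inter.2 ⟨hj₁, Finset.mem_filter.2 ⟨hsJ hj₁, hlev1 j₁ (hsJ hj₁)⟩⟩
    have h1 := hdens ((2 : ℝ) ^ top) (by positivity) (s ∩ F top) Finset.inter_subset_right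
    have h2 : (1 : ℝ) ≤ chainRank ((𝒞.image (fun s => s ∩ F top)).filter
        (fun u => u ⊆ s ∩ F top)) :=
      Nat.one_le_cast.2 (one_le_chainRank_filter_subset
        (Finset.mem_image_of_mem (fun s => s ∩ F top) hs) hjF)
    have h3 : ∑ j ∈ s ∩ F top, w j ≤ W :=
      Finset.sum_le_sum_of_subset_of_nonneg Finset.inter_subset_left fun j hj _ => (hws j hj).le
    have h4 : (0 : ℝ) < 2 ^ top := by positivity
    calc (2 : ℝ) ^ top = 2 ^ top * 1 := (mul_one _).symm
      _ ≤ _ := mul_le_mul_of_nonneg_left h2 h4.le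
      _ ≤ _ := h1
      _ ≤ _ := h3
  have hWpos : 0 < W := lt_of_lt_of_le (by positivity) hWtop
  have hsplit := Finset.sum_filter_add_sum_filter_not (s ∩ R) (fun j => top - L < lev j)
    (fun j => w j * boolSign (σ j))
  have hhigh : |∑ j ∈ (s ∩ R).filter (fun j => top - L < lev j), w j * boolSign (σ j)|
      ≤ δ / 2 * W := by
    have hmaps : ∀ j ∈ (s ∩ R).filter (fun j => top - L < lev j),
        lev j ∈ Finset.Ioc (top - L) top := by
      intro j hj
      simp only [Finset.mem_filter, Finset.mem_inter] at hj
      exact Finset.mem_Ioc.2 ⟨hj.2, hmax j hj.1.1⟩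
    rw [← Finset.sum_fiberwise_of_maps_to hmaps]
    refine (Finset.abs_sum_le_sum_abs _ _).trans ?_
    have : ∀ i ∈ Finset.Ioc (top - (L : ℤ)) top,
        |∑ j ∈ ((s ∩ R).filter (fun j => top - L < lev j)).filter (fun j => lev j = i),
          w j * boolSign (σ j)| ≤ η * W := by
      intro i hi
      have h1 : ((s ∩ R).filter (fun j => top - L < lev j)).filter (fun j => lev j = i)
          = s ∩ B i := by
        ext j
        simp only [hB, Finset.mem_inter, Finset.mem_filter]
        have := (Finset.mem_Ioc.1 hi).1
        constructor
        · tauto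
        · rintro ⟨h1, h2, rfl⟩
          exact ⟨⟨⟨h1, h2⟩, this⟩, rfl⟩
      rw [h1]
      exact hlevel i
    refine (Finset.sum_le_card_nsmul _ _ _ this).trans (le_of_eq ?_)
    rw [Int.card_Ioc, nsmul_eq_mul, show top - (top - (L : ℤ)) = L by ring, Int.toNat_natCast, hη]
    field_simp
  have hlow : |∑ j ∈ (s ∩ R).filter (fun j => ¬ top - L < lev j), w j * boolSign (σ j)|
      ≤ δ / 2 * W := by
    refine (Finset.abs_sum_le_sum_abs _ _).trans ?_
    have : ∀ j ∈ (s ∩ R).filter (fun j => ¬ top - L < lev j),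
        |w j * boolSign (σ j)| ≤ 2 * ((2 : ℝ) ^ top / 2 ^ L) / ρ := by
      intro j hj
      simp only [hR, Finset.mem_filter, Finset.mem_inter, not_lt] at hj
      have h1 : |boolSign (σ j)| = 1 := by cases σ j <;> simp [boolSign]
      rw [abs_mul, h1, mul_one, abs_of_pos (hw j hj.1.2.1)]
      refine hj.1.2.2.trans ?_
      gcongr
      refine (hlev2 j).le.trans ?_
      gcongr
      rw [← zpow_natCast, ← zpow_sub₀ (by norm_num)]
      exact zpow_le_zpow_right₀ (by norm_num) hj.2
    refine (Finset.sum_le_card_nsmul _ _ _ this).trans ?_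
    rw [nsmul_eq_mul]
    have hc : (((s ∩ R).filter (fun j => ¬ top - L < lev j)).card : ℝ) ≤ 2 ^ L := by
      have : ((s ∩ R).filter (fun j => ¬ top - L < lev j)).card ≤ 2 ^ L :=
        (Finset.card_le_card ((Finset.filter_subset _ _).trans
          (Finset.inter_subset_left.trans hsJ))).trans (hm.trans hL)
      exact_mod_cast this
    calc _ ≤ 2 ^ L * (2 * ((2 : ℝ) ^ top / 2 ^ L) / ρ) := by gcongr
      _ = 2 * 2 ^ top / ρ := by field_simp
      _ ≤ 2 * W / (4 / δ) := by gcongr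
      _ = δ / 2 * W := by field_simp; norm_num
  rw [← hsplit]
  refine (abs_add_le _ _).trans ?_
  linarith

end Signs

section Sparsify

variable {ι : Type*} [Fintype ι] [DecidableEq ι]

theorem exists_halving {𝒞 : Finset (Finset ι)} {J : Finset ι} {w : ι → ℝ}
    {ρ δ : ℝ} {m L D : ℕ} (hw : ∀ j ∈ J, 0 < w j) (hD : chainRank 𝒞 ≤ D)
    (hδ : 0 < δ) (hm : J.card ≤ m) (hL0 : 0 < L) (hL : m ≤ 2 ^ L) (hρδ : 4 / δ ≤ ρ)
    (hθ : Real.exp (-((δ / (2 * L)) ^ 2 * ρ / 8)) ≤ 1 / (8 * ((m : ℝ) + 1) ^ 3)) :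
    ∃ (J' : Finset ι) (w' : ι → ℝ), J' ⊆ J ∧ (∀ j ∈ J', 0 < w' j) ∧
      (J'.card : ℝ) ≤ J.card / 2 + ρ * D ∧
      ∀ s ∈ 𝒞, |∑ j ∈ s ∩ J', w' j - ∑ j ∈ s ∩ J, w j| ≤ δ * ∑ j ∈ s ∩ J, w j := by
  have hρ : 0 < ρ := lt_of_lt_of_le (by positivity) hρδ
  set 𝒞₁ := 𝒞.image (fun s => s ∩ J) with h𝒞₁
  have hrk : chainRank 𝒞₁ ≤ D := by
    have h1 := chainRank_image_add_filter_le 𝒞 Jᶜ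
    simp only [sdiff_compl, Finset.inf_eq_inter] at h1
    exact (Nat.le_add_right _ _).trans (h1.trans hD)
  set J₁ := 𝒞₁.sup id with hJ₁
  have hJ₁J : J₁ ⊆ J := Finset.sup_le fun s hs => by
    obtain ⟨u, _, rfl⟩ := Finset.mem_image.1 hs
    exact Finset.inter_subset_right
  have hw₁ : ∀ j ∈ J₁, 0 < w j := fun j hj => hw j (hJ₁J hj)
  obtain ⟨κ, hκ, hκsum, hκd⟩ := exists_strength (𝒞 := 𝒞₁) hw₁
    (fun s hs => subset_sup_id hs) (fun j hj => Finset.mem_sup.1 hj)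
  obtain ⟨σ₀, hσ₀⟩ := exists_signs_abs_sum_le (𝒞 := 𝒞₁) (fun s hs => subset_sup_id hs) hw₁ hκ hκd
    hδ ((Finset.card_le_card hJ₁J).trans hm) hL0 hL hρδ hθ
  set R := J₁.filter (fun j => w j ≤ κ j / ρ) with hR
  set K := J₁.filter (fun j => ¬ w j ≤ κ j / ρ) with hK
  obtain ⟨σ, hσ, hcard⟩ : ∃ σ : ι → Bool,
      (∀ s ∈ 𝒞₁, |∑ j ∈ s ∩ R, w j * boolSign (σ j)| ≤ δ * ∑ j ∈ s, w j) ∧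
      2 * (R.filter (fun j => σ j = true)).card ≤ R.card := by
    have h1 := Finset.card_filter_add_card_filter_not (s := R) (fun j => σ₀ j = true)
    rcases le_total (R.filter (fun j => σ₀ j = true)).card
      (R.filter (fun j => ¬ σ₀ j = true)).card with h | h
    · exact ⟨σ₀, hσ₀, by omega⟩
    · refine ⟨fun j => !σ₀ j, fun s hs => ?_, ?_⟩
      · simpa [boolSign_not] using hσ₀ s hs
      · have h2 : R.filter (fun j => (!σ₀ j) = true) = R.filter (fun j => ¬ σ₀ j = true) := by
          simp
        rw [h2]
        omega
  have hKcard : (K.card : ℝ) ≤ ρ * D := by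
    have h1 : (K.card : ℝ) ≤ ∑ j ∈ K, ρ * (w j / κ j) := by
      have := Finset.card_nsmul_le_sum K (fun j => ρ * (w j / κ j)) 1 fun j hj => by
        obtain ⟨hjJ, hjw⟩ := Finset.mem_filter.1 hj
        have hκj := hκ j hjJ
        rw [not_le, div_lt_iff₀ hρ] at hjw
        rw [← mul_div_assoc, one_le_div hκj]
        linarith
      simpa using this
    rw [← Finset.mul_sum] at h1
    refine h1.trans (mul_le_mul_of_nonneg_left ?_ hρ.le)
    calc ∑ j ∈ K, w j / κ j ≤ ∑ j ∈ J₁, w j / κ j :=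
          Finset.sum_le_sum_of_subset_of_nonneg (Finset.filter_subset _ _)
            fun j hj _ => (div_pos (hw₁ j hj) (hκ j hj)).le
      _ ≤ chainRank 𝒞₁ := hκsum
      _ ≤ D := Nat.cast_le.2 hrk
  set A := R.filter (fun j => σ j = true) with hA
  have hRJ : R ⊆ J₁ := Finset.filter_subset _ _
  have hAR : A ⊆ R := Finset.filter_subset _ _
  have hKJ : K ⊆ J₁ := Finset.filter_subset _ _
  refine ⟨K ∪ A, fun j => if w j ≤ κ j / ρ then 2 * w j else w j,
    (Finset.union_subset hKJ (hAR.trans hRJ)).trans hJ₁J, ?_, ?_, ?_⟩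
  · intro j hj
    have := hw₁ j (Finset.union_subset hKJ (hAR.trans hRJ) hj)
    dsimp only
    split_ifs <;> linarith
  · have h1 : ((K ∪ A).card : ℝ) ≤ K.card + A.card := by exact_mod_cast Finset.card_union_le _ _
    have h2 : (2 : ℝ) * A.card ≤ J.card := by
      exact_mod_cast hcard.trans (Finset.card_le_card (hRJ.trans hJ₁J))
    linarith
  · intro s hs
    have hs₁ : s ∩ J ∈ 𝒞₁ := Finset.mem_image_of_mem _ hs
    have hsJ₁ : s ∩ J ⊆ J₁ := subset_sup_id hs₁
    refine le_trans (le_of_eq ?_) (hσ _ hs₁)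
    congr 1
    have e1 : ∀ g : ι → ℝ, ∑ j ∈ s ∩ (K ∪ A), g j = ∑ j ∈ s ∩ J,
        if w j ≤ κ j / ρ then (if σ j = true then g j else 0) else g j := by
      intro g
      have : s ∩ (K ∪ A) = (s ∩ J).filter
          (fun j => w j ≤ κ j / ρ → σ j = true) := by
        ext j
        have h1 := @hsJ₁ j
        have h2 := @hJ₁J j
        simp only [hA, hR, hK, Finset.mem_inter, Finset.mem_union, Finset.mem_filter] at *
        tauto
      rw [this, Finset.sum_filter]
      refine Finset.sum_congr rfl fun j _ => ?_
      by_cases h : w j ≤ κ j / ρ <;> simp [h]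
    have e2 : ∀ g : ι → ℝ, ∑ j ∈ s ∩ J ∩ R, g j
        = ∑ j ∈ s ∩ J, if w j ≤ κ j / ρ then g j else 0 := by
      intro g
      have : s ∩ J ∩ R = (s ∩ J).filter (fun j => w j ≤ κ j / ρ) := by
        ext j
        have h1 := @hsJ₁ j
        simp only [hR, Finset.mem_inter, Finset.mem_filter] at *
        tauto
      rw [this, Finset.sum_filter]
    rw [e1, e2, ← Finset.sum_sub_distrib]
    refine Finset.sum_congr rfl fun j _ => ?_
    by_cases h : w j ≤ κ j / ρ
    · by_cases h' : σ j = true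
      · simp [h, h', boolSign]; ring
      · simp [h, h', boolSign]
    · simp [h]

theorem exists_iterated_halving {𝒞 : Finset (Finset ι)} {J : Finset ι} {w : ι → ℝ}
    {ρ δ : ℝ} {m L D : ℕ} (hw : ∀ j ∈ J, 0 < w j) (hD : chainRank 𝒞 ≤ D)
    (hδ : 0 < δ) (hδ1 : δ < 1) (hm : J.card ≤ m) (hL0 : 0 < L) (hL : m ≤ 2 ^ L) (hρδ : 4 / δ ≤ ρ)
    (hθ : Real.exp (-((δ / (2 * L)) ^ 2 * ρ / 8)) ≤ 1 / (8 * ((m : ℝ) + 1) ^ 3)) (k : ℕ) :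
    ∃ (J' : Finset ι) (w' : ι → ℝ), J' ⊆ J ∧ (∀ j ∈ J', 0 < w' j) ∧
      (J'.card : ℝ) ≤ J.card / 2 ^ k + 2 * (ρ * D) ∧
      ∀ s ∈ 𝒞, (1 - δ) ^ k * ∑ j ∈ s ∩ J, w j ≤ ∑ j ∈ s ∩ J', w' j ∧
        ∑ j ∈ s ∩ J', w' j ≤ (1 + δ) ^ k * ∑ j ∈ s ∩ J, w j := by
  have hρ : 0 < ρ := lt_of_lt_of_le (by positivity) hρδ
  induction k with
  | zero => exact ⟨J, w, subset_rfl, hw, by simp; positivity, by simp⟩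
  | succ k ih =>
    obtain ⟨J₁, w₁, hJ₁, hw₁, hc₁, h₁⟩ := ih
    obtain ⟨J₂, w₂, hJ₂, hw₂, hc₂, h₂⟩ := exists_halving hw₁ hD hδ
      ((Finset.card_le_card hJ₁).trans hm) hL0 hL hρδ hθ
    refine ⟨J₂, w₂, hJ₂.trans hJ₁, hw₂, ?_, fun s hs => ?_⟩
    · calc (J₂.card : ℝ) ≤ J₁.card / 2 + ρ * D := hc₂
        _ ≤ (J.card / 2 ^ k + 2 * (ρ * D)) / 2 + ρ * D := by gcongr
        _ = _ := by rw [pow_succ]; field_simp; ring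
    · obtain ⟨hlo, hhi⟩ := abs_le.1 (h₂ s hs)
      obtain ⟨hlo₁, hhi₁⟩ := h₁ s hs
      constructor
      · calc (1 - δ) ^ (k + 1) * ∑ j ∈ s ∩ J, w j
            = (1 - δ) * ((1 - δ) ^ k * ∑ j ∈ s ∩ J, w j) := by ring
          _ ≤ (1 - δ) * ∑ j ∈ s ∩ J₁, w₁ j := mul_le_mul_of_nonneg_left hlo₁ (by linarith)
          _ ≤ _ := by linarith
      · calc ∑ j ∈ s ∩ J₂, w₂ j ≤ (1 + δ) * ∑ j ∈ s ∩ J₁, w₁ j := by linarith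
          _ ≤ (1 + δ) * ((1 + δ) ^ k * ∑ j ∈ s ∩ J, w j) :=
            mul_le_mul_of_nonneg_left hhi₁ (by linarith)
          _ = _ := by ring

theorem clog_two_le_logb {m : ℕ} (hm : 1 ≤ m) : (Nat.clog 2 m : ℝ) ≤ Real.logb 2 m + 1 := by
  rcases hm.eq_or_lt with rfl | h
  · simp
  have h1 := Nat.pow_pred_clog_lt_self (b := 2) (by norm_num) h
  have h2 : 0 < Nat.clog 2 m := Nat.clog_pos (by norm_num) h
  have h3 : ((Nat.clog 2 m - 1 : ℕ) : ℝ) ≤ Real.logb 2 m := by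
    rw [Real.le_logb_iff_rpow_le (by norm_num) (by exact_mod_cast hm), Real.rpow_natCast]
    exact_mod_cast h1.le
  rw [Nat.cast_sub h2] at h3
  push_cast at h3
  linarith

/-- A weighted set family of chain length at most `D` on at most `m` coordinates has a sparsifier
of size `D` up to polylogarithmic factors. -/
theorem exists_family_sparsifier {𝒞 : Finset (Finset ι)} {J : Finset ι} {w : ι → ℝ} {ε : ℝ}
    {m D : ℕ} (hw : ∀ j ∈ J, 0 < w j) (hD : chainRank 𝒞 ≤ D) (hD1 : 1 ≤ D) (hm1 : 1 ≤ m)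
    (hm : J.card ≤ m) (hε : 0 < ε) (hε1 : ε < 1) :
    ∃ (J' : Finset ι) (w' : ι → ℝ), J' ⊆ J ∧ (∀ j ∈ J', 0 < w' j) ∧
      (J'.card : ℝ) ≤ 24577 * D * Real.logb 2 (2 * m / ε) ^ 5 / ε ^ 2 ∧
      ∀ s ∈ 𝒞, (1 - ε) * ∑ j ∈ s ∩ J, w j ≤ ∑ j ∈ s ∩ J', w' j ∧
        ∑ j ∈ s ∩ J', w' j ≤ (1 + ε) * ∑ j ∈ s ∩ J, w j := by
  set L := Nat.clog 2 m + 1 with hLdef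
  have hL0 : 0 < L := Nat.succ_pos _
  have hLr : (1 : ℝ) ≤ L := by exact_mod_cast hL0
  have hL : m ≤ 2 ^ L := (Nat.le_pow_clog (by norm_num) m).trans
    (Nat.pow_le_pow_right (by norm_num) (Nat.le_succ _))
  have hm0 : (1 : ℝ) ≤ m := by exact_mod_cast hm1
  set δ := ε / (2 * L) with hδdef
  have hδ : 0 < δ := by positivity
  have hδ1 : δ < 1 := by
    rw [hδdef, div_lt_one (by positivity)]
    linarith
  set lg := Real.log (2 * ((m : ℝ) + 1)) with hlg
  have hlg1 : 1 ≤ lg := by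
    have h4 : Real.log (2 * 2) ≤ lg := Real.log_le_log (by norm_num) (by linarith)
    rw [Real.log_mul (by norm_num) (by norm_num)] at h4
    have := Real.log_two_gt_d9
    linarith
  set ρ := 24 * lg * (2 * L) ^ 2 / δ ^ 2 with hρdef
  have hρδ : 4 / δ ≤ ρ := by
    rw [hρdef, div_le_div_iff₀ hδ (by positivity)]
    have h1 : δ ^ 2 ≤ δ := by nlinarith
    have h2 : (1 : ℝ) ≤ (2 * L) ^ 2 := one_le_pow₀ (by linarith)
    have h3 : (4 : ℝ) ≤ 24 * lg * (2 * L) ^ 2 := by nlinarith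
    nlinarith
  have hθ : Real.exp (-((δ / (2 * L)) ^ 2 * ρ / 8)) ≤ 1 / (8 * ((m : ℝ) + 1) ^ 3) := by
    have h1 : (δ / (2 * L)) ^ 2 * ρ / 8 = (3 : ℕ) * lg := by
      rw [hρdef]
      field_simp
      norm_num
    rw [h1, Real.exp_neg, Real.exp_nat_mul, hlg, Real.exp_log (by positivity), mul_pow, one_div]
    norm_num
  obtain ⟨J', w', hJ', hw', hc, happ⟩ := exists_iterated_halving hw hD hδ hδ1 hm hL0 hL hρδ hθ L
  refine ⟨J', w', hJ', hw', ?_, fun s hs => ?_⟩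
  · set Λ := Real.logb 2 (2 * m / ε) with hΛ
    have hΛm : Real.logb 2 m + 1 ≤ Λ := by
      have h1 : Real.logb 2 (2 * m) = 1 + Real.logb 2 m := by
        rw [Real.logb_mul (by norm_num) (by positivity), Real.logb_self_eq_one (by norm_num)]
      have h2 : Real.logb 2 (2 * m) ≤ Λ := by
        refine Real.logb_le_logb_of_le (by norm_num) (by positivity) ?_
        rw [le_div_iff₀ hε]
        nlinarith
      linarith
    have hlm : 0 ≤ Real.logb 2 m := Real.logb_nonneg (by norm_num) hm0
    have hLΛ : (L : ℝ) ≤ 2 * Λ := by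
      have := clog_two_le_logb hm1
      rw [hLdef]
      push_cast
      linarith
    have hlgΛ : lg ≤ 2 * Λ := by
      have h1 : lg ≤ Real.log (2 ^ 2 * m) := Real.log_le_log (by positivity) (by linarith)
      rw [Real.log_mul (by norm_num) (by positivity), Real.log_pow] at h1
      have h2 : Real.log m = Real.logb 2 m * Real.log 2 := by
        rw [Real.logb, div_mul_cancel₀ _ (Real.log_pos (by norm_num)).ne']
      rw [h2] at h1
      have := Real.log_two_lt_d9
      push_cast at h1
      nlinarith
    have hΛ1 : 1 ≤ Λ := by linarith
    have hρΛ : ρ ≤ 12288 * Λ ^ 5 / ε ^ 2 := by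
      have h1 : ρ = 384 * lg * (L : ℝ) ^ 4 / ε ^ 2 := by
        rw [hρdef, hδdef]
        field_simp
        norm_num
      rw [h1]
      have h2 : (L : ℝ) ^ 4 ≤ (2 * Λ) ^ 4 := by gcongr
      refine div_le_div_of_nonneg_right ?_ (by positivity)
      calc 384 * lg * (L : ℝ) ^ 4 ≤ 384 * (2 * Λ) * (2 * Λ) ^ 4 := by gcongr
        _ = 12288 * Λ ^ 5 := by ring
    have hJm : (J.card : ℝ) / 2 ^ L ≤ 1 := by
      rw [div_le_one (by positivity)]
      exact_mod_cast hm.trans hL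
    have hD1' : (1 : ℝ) ≤ D := by exact_mod_cast hD1
    have hbig : (1 : ℝ) ≤ D * Λ ^ 5 / ε ^ 2 := by
      rw [one_le_div (by positivity)]
      have h1 : ε ^ 2 ≤ 1 := pow_le_one₀ hε.le hε1.le
      have h2 : (1 : ℝ) ≤ Λ ^ 5 := one_le_pow₀ hΛ1
      nlinarith
    calc (J'.card : ℝ) ≤ J.card / 2 ^ L + 2 * (ρ * D) := hc
      _ ≤ D * Λ ^ 5 / ε ^ 2 + 2 * (12288 * Λ ^ 5 / ε ^ 2 * D) := by
        have : ρ * D ≤ 12288 * Λ ^ 5 / ε ^ 2 * D := by gcongr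
        linarith
      _ = _ := by ring
  · have hnn : 0 ≤ ∑ j ∈ s ∩ J, w j :=
      Finset.sum_nonneg fun j hj => (hw j (Finset.mem_inter.1 hj).2).le
    have hLδ : L * δ = ε / 2 := by rw [hδdef]; field_simp
    have hlo : 1 - ε ≤ (1 - δ) ^ L := by
      have := one_add_mul_le_pow (a := -δ) (by linarith) L
      rw [← sub_eq_add_neg] at this
      linarith
    have hhi : (1 + δ) ^ L ≤ 1 + ε := by
      calc (1 + δ) ^ L ≤ Real.exp δ ^ L := by
            gcongr
            linarith [Real.add_one_le_exp δ]
        _ = Real.exp (ε / 2) := by rw [← Real.exp_nat_mul, hLδ]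
        _ ≤ 1 / (1 - ε / 2) := Real.exp_bound_div_one_sub_of_interval (by linarith) (by linarith)
        _ ≤ 1 + ε := by
            rw [div_le_iff₀ (by linarith)]
            nlinarith
    obtain ⟨h1, h2⟩ := happ s hs
    exact ⟨(mul_le_mul_of_nonneg_right hlo hnn).trans h1,
      h2.trans (mul_le_mul_of_nonneg_right hhi hnn)⟩

end Sparsify

section Lattice

theorem two_pow_cardFactors_le {n : ℕ} (hn : n ≠ 0) : 2 ^ ArithmeticFunction.cardFactors n ≤ n := by
  rw [ArithmeticFunction.cardFactors_apply]
  conv_rhs => rw [← Nat.prod_primeFactorsList hn]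
  exact List.pow_card_le_prod _ _ fun p hp => (Nat.prime_of_mem_primeFactorsList hp).two_le

theorem cardFactors_lt_of_dvd {a b : ℕ} (hb : b ≠ 0) (h : a ∣ b) (hne : a ≠ b) :
    ArithmeticFunction.cardFactors a < ArithmeticFunction.cardFactors b := by
  obtain ⟨c, rfl⟩ := h
  have ha : a ≠ 0 := left_ne_zero_of_mul hb
  have hc : c ≠ 0 := right_ne_zero_of_mul hb
  have hc1 : 1 < c := by
    rcases Nat.lt_or_ge 1 c with h | h
    · exact h
    · exact absurd (by rw [show c = 1 by omega, mul_one]) hne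
  rw [ArithmeticFunction.cardFactors_mul ha hc]
  have := ArithmeticFunction.cardFactors_pos_iff_one_lt.2 hc1
  omega

variable {κ : Type*} [Fintype κ] [DecidableEq κ]

theorem exists_matrix_rows_span {B : Set (κ → ℤ)} (hB : ∀ b ∈ B, ∀ i, |b i| ≤ 1) :
    ∃ (M : Matrix κ κ ℤ) (I : Set κ), M.det ≠ 0 ∧ (∀ k i, |M k i| ≤ 1) ∧ (∀ k ∈ I, M k ∈ B) ∧
      ∀ b ∈ B, (fun i => (b i : ℚ)) ∈ Submodule.span ℚ ((fun k i => (M k i : ℚ)) '' I) := by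
  classical
  let f : (κ → ℤ) → (κ → ℚ) := fun v i => v i
  let stdBasis : Set (κ → ℤ) := Set.range fun k => Pi.single k 1
  obtain ⟨b₀, hb₀B, -, hBb₀, hb₀⟩ := exists_linearIndepOn_id_extension
    (K := ℚ) (s := ∅) (t := f '' B) (linearIndepOn_empty _ _) (Set.empty_subset _)
  obtain ⟨b₁, hb₁t, hb₀₁, htb₁, hb₁⟩ := exists_linearIndepOn_id_extension
    (K := ℚ) (t := f '' (B ∪ stdBasis)) hb₀ (hb₀B.trans (Set.image_mono Set.subset_union_left))
  have hspan : ⊤ ≤ Submodule.span ℚ (Set.range (Subtype.val : b₁ → κ → ℚ)) := by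
    rw [Subtype.range_coe, ← (Pi.basisFun ℚ κ).span_eq, Submodule.span_le]
    rintro _ ⟨k, rfl⟩
    refine htb₁ ⟨Pi.single k 1, Or.inr ⟨k, rfl⟩, ?_⟩
    ext i
    simp [f, Pi.single_apply]
  let e : κ ≃ b₁ := (Pi.basisFun ℚ κ).indexEquiv (Module.Basis.mk hb₁ hspan)
  have hrow : ∀ k, ∃ v, f v = e k ∧ ((e k : κ → ℚ) ∈ b₀ → v ∈ B) ∧ ∀ i, |v i| ≤ 1 := by
    intro k
    by_cases h : (e k : κ → ℚ) ∈ b₀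
    · obtain ⟨v, hv, hve⟩ := hb₀B h
      exact ⟨v, hve, fun _ => hv, hB v hv⟩
    · obtain ⟨v, hv, hve⟩ := hb₁t (e k).2
      refine ⟨v, hve, fun h' => absurd h' h, ?_⟩
      rcases hv with hv | ⟨k', rfl⟩
      · exact hB v hv
      · intro i
        simp only [Pi.single_apply]
        split_ifs <;> simp
  choose M hM hMB hM1 using hrow
  refine ⟨M, {k | (e k : κ → ℚ) ∈ b₀}, ?_, hM1, fun k hk => hMB k hk, fun b hb => ?_⟩
  · have hli : LinearIndependent ℚ (fun k => f (M k)) := by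
      have : (fun k => f (M k)) = (fun x : b₁ => (x : κ → ℚ)) ∘ e := funext hM
      rw [this]
      exact LinearIndependent.comp hb₁ e e.injective
    have hu : IsUnit (Matrix.map M (Int.castRingHom ℚ) : Matrix κ κ ℚ) :=
      Matrix.linearIndependent_rows_iff_isUnit.1 hli
    rw [Matrix.isUnit_iff_isUnit_det, isUnit_iff_ne_zero] at hu
    intro h0
    apply hu
    have := (Int.castRingHom ℚ).map_det M
    rw [h0, map_zero] at this
    exact this.symm
  · refine Submodule.span_mono ?_ (hBb₀ ⟨b, hb, rfl⟩)
    intro v hv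
    refine ⟨e.symm ⟨v, hb₀₁ hv⟩, by simpa using hv, ?_⟩
    have := hM (e.symm ⟨v, hb₀₁ hv⟩)
    simpa [f] using this

theorem exists_modulus {B : Set (κ → ℤ)} (hB : ∀ b ∈ B, ∀ i, |b i| ≤ 1) {X : Set (κ → ℤ)}
    (hX : X.Finite) :
    ∃ E : ℕ, E ≠ 0 ∧ ArithmeticFunction.cardFactors E ≤ Fintype.card κ ^ 2 + 1 ∧
      ∀ x ∈ X, (fun i => (x i : ZMod E)) ∈
          AddSubgroup.closure ((fun (b : κ → ℤ) i => (b i : ZMod E)) '' B) →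
        x ∈ AddSubgroup.closure B := by
  obtain ⟨M, I, hdet, hM1, hMB, hspan⟩ := exists_matrix_rows_span hB
  let c : (κ → ℤ) → κ → ℤ := fun x => Matrix.vecMul x M.adjugate
  have hc : ∀ x, Matrix.vecMul (c x) M = M.det • x := by
    intro x
    simp [c, Matrix.vecMul_vecMul, Matrix.adjugate_mul]
  have hcB : ∀ b ∈ B, ∀ k ∉ I, c b k = 0 := by
    intro b hb k hk
    have hcast : ∀ v : κ → ℤ, Matrix.vecMul (fun i => (v i : ℚ))
        (M.adjugate.map (Int.castRingHom ℚ)) k = ((c v k : ℤ) : ℚ) := fun v =>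
      (RingHom.map_vecMul (Int.castRingHom ℚ) M.adjugate v k).symm
    have hle : Submodule.span ℚ ((fun k i => (M k i : ℚ)) '' I) ≤ LinearMap.ker
        (LinearMap.proj k ∘ₗ Matrix.vecMulLinear (M.adjugate.map (Int.castRingHom ℚ))) := by
      rw [Submodule.span_le]
      rintro _ ⟨j, hj, rfl⟩
      have hjk : j ≠ k := fun h => hk (h ▸ hj)
      have h0 : c (M j) k = 0 := by
        have : c (M j) k = (M * M.adjugate) j k := rfl
        rw [this, Matrix.mul_adjugate, Matrix.smul_apply, Matrix.one_apply_ne hjk, smul_zero]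
      have := hcast (M j)
      rw [h0] at this
      simpa using this
    have := hle (hspan b hb)
    rw [LinearMap.mem_ker] at this
    have h2 := hcast b
    have h3 : ((c b k : ℤ) : ℚ) = 0 := by rw [← h2]; exact this
    exact_mod_cast h3
  have hcadd : ∀ x y, c (x + y) = c x + c y := fun x y => Matrix.add_vecMul _ _ _
  have hcsmul : ∀ (a : ℤ) x, c (a • x) = a • c x := fun a x => Matrix.smul_vecMul _ _ _
  have hcneg : ∀ x, c (-x) = -c x := fun x => Matrix.neg_vecMul _ _
  have hczero : c 0 = 0 := Matrix.zero_vecMul _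
  have hccl : ∀ x ∈ AddSubgroup.closure B, ∀ k ∉ I, c x k = 0 := by
    intro x hx k hk
    induction hx using AddSubgroup.closure_induction with
    | mem b hb => exact hcB b hb k hk
    | zero => rw [hczero]; rfl
    | add x y _ _ h1 h2 => rw [hcadd, Pi.add_apply, h1, h2, add_zero]
    | neg x _ h => rw [hcneg, Pi.neg_apply, h, neg_zero]
  obtain ⟨b, hb⟩ : ∃ b : ℕ, ∀ x ∈ X, ∀ k, (c x k).natAbs ≤ b := by
    refine ⟨∑ x ∈ hX.toFinset, ∑ k, (c x k).natAbs, fun x hx k => ?_⟩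
    calc (c x k).natAbs ≤ ∑ k, (c x k).natAbs :=
          Finset.single_le_sum (f := fun k => (c x k).natAbs) (fun _ _ => Nat.zero_le _)
            (Finset.mem_univ k)
      _ ≤ _ := Finset.single_le_sum (f := fun x => ∑ k, (c x k).natAbs)
          (fun _ _ => Nat.zero_le _) (hX.mem_toFinset.2 hx)
  obtain ⟨p, hbp, hp⟩ := Nat.exists_infinite_primes (b + 1)
  have hd0 : M.det.natAbs ≠ 0 := Int.natAbs_ne_zero.2 hdet
  have hE0 : p * M.det.natAbs ≠ 0 := mul_ne_zero hp.ne_zero hd0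
  refine ⟨p * M.det.natAbs, hE0, ?_, fun x hx hxcl => ?_⟩
  · rw [ArithmeticFunction.cardFactors_mul hp.ne_zero hd0,
      ArithmeticFunction.cardFactors_apply_prime hp, add_comm]
    gcongr
    refine (Nat.pow_le_pow_iff_right (a := 2) (by norm_num)).1
      ((two_pow_cardFactors_le hd0).trans ?_)
    have h1 : |M.det| ≤ (Fintype.card κ).factorial • (1 : ℤ) ^ Fintype.card κ := by
      have := Matrix.det_le (A := M) (abv := IsAbsoluteValue.toAbsoluteValue (abs : ℤ → ℤ))
        (x := 1) (fun i j => hM1 i j)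
      exact this
    have h2 : M.det.natAbs ≤ (Fintype.card κ).factorial := by
      rw [one_pow, nsmul_one, Int.abs_eq_natAbs] at h1
      exact_mod_cast h1
    calc M.det.natAbs ≤ (Fintype.card κ).factorial := h2
      _ ≤ Fintype.card κ ^ Fintype.card κ := Nat.factorial_le_pow _
      _ ≤ (2 ^ Fintype.card κ) ^ Fintype.card κ := by
          gcongr
          exact Nat.lt_two_pow_self.le
      _ = 2 ^ Fintype.card κ ^ 2 := by rw [← pow_mul, sq]
  · set E := p * M.det.natAbs with hE
    let q : (κ → ℤ) →+ (κ → ZMod E) :=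
      AddMonoidHom.compLeft (Int.castAddHom (ZMod E)) κ
    have hq : (fun (b : κ → ℤ) i => (b i : ZMod E)) = q := rfl
    rw [hq, ← AddMonoidHom.map_closure] at hxcl
    obtain ⟨y, hy, hyx⟩ := hxcl
    have hdvd : ∀ i, (E : ℤ) ∣ x i - y i := by
      intro i
      rw [← ZMod.intCast_eq_intCast_iff_dvd_sub]
      exact congrFun hyx i
    choose z hz using hdvd
    have hxz : x = y + (E : ℤ) • z := by
      ext i
      have := hz i
      simp only [Pi.add_apply, Pi.smul_apply, smul_eq_mul]
      linarith
    have hcz : ∀ k ∉ I, c z k = 0 := by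
      intro k hk
      have h1 : c x k = E * c z k := by
        rw [hxz, hcadd, hcsmul, Pi.add_apply, hccl y hy k hk, zero_add, Pi.smul_apply, smul_eq_mul]
      have h2 : c x k = 0 := by
        refine Int.eq_zero_of_abs_lt_dvd (m := (E : ℤ)) ⟨_, h1⟩ ?_
        rw [Int.abs_eq_natAbs]
        have := hb x hx k
        have : p ≤ E := Nat.le_mul_of_pos_right _ (Nat.pos_of_ne_zero hd0)
        exact_mod_cast (by omega : (c x k).natAbs < E)
      rw [h2] at h1
      rcases mul_eq_zero.1 h1.symm with h | h
      · exact absurd (by exact_mod_cast h) hE0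
      · exact h
    have hdz : M.det • z ∈ AddSubgroup.closure B := by
      rw [← hc z, Matrix.vecMul_eq_sum]
      refine AddSubgroup.sum_mem _ fun k _ => ?_
      by_cases hk : k ∈ I
      · exact AddSubgroup.zsmul_mem _ (AddSubgroup.subset_closure (hMB k hk)) _
      · rw [hcz k hk, zero_smul]
        exact AddSubgroup.zero_mem _
    have hEz : (E : ℤ) • z ∈ AddSubgroup.closure B := by
      obtain ⟨u, hu⟩ : M.det ∣ (E : ℤ) := by
        rw [hE]
        push_cast
        exact Dvd.dvd.mul_left (by simp) _
      rw [hu, mul_comm, mul_smul]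
      exact AddSubgroup.zsmul_mem _ hdz _
    rw [hxz]
    exact AddSubgroup.add_mem _ hy hEz

end Lattice

section Predicate

theorem HasChain.le_cardFactors {ι : Type*} [DecidableEq ι] {G : Type*} [AddCommGroup G] [Finite G]
    {𝒞 : Finset (Finset ι)} {k : ℕ} (V : ι → AddSubgroup G) (H : AddSubgroup G)
    (h : ∀ s ∈ 𝒞, ∃ g ∈ H, ∀ j, j ∈ s ↔ g ∉ V j) (hc : HasChain k 𝒞) :
    k ≤ ArithmeticFunction.cardFactors (Nat.card H) := by
  induction k generalizing 𝒞 H with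
  | zero => exact Nat.zero_le _
  | succ k ih =>
    obtain ⟨j, ⟨s, hs, hj⟩, hk⟩ := hc
    have h1 := ih (H ⊓ V j) (fun s' hs' => by
      obtain ⟨hs', hj'⟩ := Finset.mem_filter.1 hs'
      obtain ⟨g, hg, hgs⟩ := h s' hs'
      exact ⟨g, ⟨hg, not_not.1 fun hg' => hj' ((hgs j).2 hg')⟩, hgs⟩) hk
    refine Nat.succ_le_of_lt (h1.trans_lt (cardFactors_lt_of_dvd Nat.card_pos.ne'
      (AddSubgroup.card_dvd_of_le inf_le_left) fun hcard => ?_))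
    obtain ⟨g, hg, hgs⟩ := h s hs
    have heq : H ⊓ V j = H := SetLike.coe_injective
      (Set.eq_of_subset_of_ncard_le inf_le_left hcard.ge (Set.toFinite _))
    exact (hgs j).1 hj (heq.ge hg).2

theorem card_finset_card_le (α : Type*) [Fintype α] [DecidableEq α] (l : ℕ) :
    Fintype.card {S : Finset α // S.card ≤ l} ≤ Fintype.card α ^ l + 1 := by
  let f : Option (Fin l → α) → {S : Finset α // S.card ≤ l}
    | none => ⟨∅, Nat.zero_le _⟩
    | some g => ⟨Finset.univ.image g, Finset.card_image_le.trans (by simp)⟩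
  have hf : Function.Surjective f := by
    rintro ⟨S, hS⟩
    rcases S.eq_empty_or_nonempty with rfl | hne
    · exact ⟨none, rfl⟩
    · have : Nonempty S := hne.to_subtype
      obtain ⟨e⟩ : Nonempty (S ↪ Fin l) :=
        Function.Embedding.nonempty_of_card_le (by simpa using hS)
      have hsurj := Function.invFun_surjective e.injective
      refine ⟨some fun i => ((Function.invFun e i : S) : α), Subtype.ext ?_⟩
      ext x
      simp only [f, Finset.mem_image, Finset.mem_univ, true_and]
      constructor
      · rintro ⟨i, rfl⟩
        exact (Function.invFun e i).2
      · intro hx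
        obtain ⟨i, hi⟩ := hsurj ⟨x, hx⟩
        exact ⟨i, by rw [hi]⟩
  simpa using Fintype.card_le_of_surjective f hf

/-- The value at `x` of the multilinear monomial with support `S`. -/
def multilinearMonomial {α : Type*} (x : α → Bool) (S : Finset α) : ℤ :=
  if ∀ i ∈ S, x i = true then 1 else 0

theorem abs_multilinearMonomial_le {α : Type*} (x : α → Bool) (S : Finset α) :
    |multilinearMonomial x S| ≤ 1 := by
  unfold multilinearMonomial
  split_ifs <;> simp

theorem multilinearMonomial_image {α β : Type*} [DecidableEq β] (a : β → Bool) (f : α → β)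
    (S : Finset α) :
    multilinearMonomial a (S.image f) = multilinearMonomial (fun i => a (f i)) S := by
  simp [multilinearMonomial]

theorem prod_ite_pow_eq {α : Type*} [Fintype α] (x : α → Bool) (μ : α → ℕ) :
    ∏ i, (if x i then (1 : ℤ) else 0) ^ μ i =
      multilinearMonomial x (Finset.univ.filter fun i => μ i ≠ 0) := by
  unfold multilinearMonomial
  split_ifs with h
  · refine Finset.prod_eq_one fun i _ => ?_
    by_cases hi : μ i = 0
    · rw [hi, pow_zero]
    · rw [h i (by simpa using hi), if_pos rfl, one_pow]
  · push Not at h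
    obtain ⟨i, hi, hx⟩ := h
    refine Finset.prod_eq_zero (Finset.mem_univ i) ?_
    rw [if_neg hx, zero_pow (by simpa using hi)]

theorem card_filter_ne_zero_le_sum {α : Type*} [Fintype α] (μ : α → ℕ) :
    (Finset.univ.filter fun i => μ i ≠ 0).card ≤ ∑ i, μ i := by
  rw [Finset.card_filter]
  refine Finset.sum_le_sum fun i _ => ?_
  split_ifs with h
  · exact Nat.one_le_iff_ne_zero.2 h
  · exact Nat.zero_le _

theorem exists_zmod_subgroup {A : Type*} [AddCommGroup A] {l r : ℕ} {P : (Fin r → Bool) → Bool}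
    {T : ℕ} {μ : Fin T → Fin r → ℕ} {coef : Fin T → A} (hμ : ∀ j, ∑ i, μ j i ≤ l)
    (hP : ∀ x : Fin r → Bool, P x = true ↔
      ∑ j, (∏ i, (if x i then (1 : ℤ) else 0) ^ μ j i) • coef j ≠ 0) :
    ∃ E : ℕ, E ≠ 0 ∧ ArithmeticFunction.cardFactors E ≤ (r ^ l + 1) ^ 2 + 1 ∧
      ∃ V : AddSubgroup ({S : Finset (Fin r) // S.card ≤ l} → ZMod E), ∀ x : Fin r → Bool,
        P x = true ↔ (fun S => (multilinearMonomial x S.1 : ZMod E)) ∉ V := by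
  classical
  let v : (Fin r → Bool) → {S : Finset (Fin r) // S.card ≤ l} → ℤ :=
    fun x S => multilinearMonomial x S.1
  let B := v '' {x | ¬P x = true}
  obtain ⟨E, hE0, hE, hBE⟩ := exists_modulus (B := B) (X := Set.range v)
    (by rintro _ ⟨x, -, rfl⟩ S; exact abs_multilinearMonomial_le _ _) (Set.finite_range v)
  refine ⟨E, hE0, hE.trans ?_, AddSubgroup.closure ((fun b S => (b S : ZMod E)) '' B), fun x => ?_⟩
  · have := card_finset_card_le (Fin r) l
    rw [Fintype.card_fin] at this
    gcongr
  · constructor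
    · intro hx hmem
      let Q : ({S : Finset (Fin r) // S.card ≤ l} → ℤ) →+ A :=
        { toFun := fun u => ∑ j, u ⟨Finset.univ.filter fun i => μ j i ≠ 0,
            (card_filter_ne_zero_le_sum _).trans (hμ j)⟩ • coef j
          map_zero' := by simp
          map_add' := by simp [add_smul, Finset.sum_add_distrib] }
      have hQ : ∀ x, P x = true ↔ Q (v x) ≠ 0 := by
        intro x
        rw [hP]
        simp only [prod_ite_pow_eq]
        rfl
      have hker : AddSubgroup.closure B ≤ Q.ker := by
        rw [AddSubgroup.closure_le]
        rintro _ ⟨y, hy, rfl⟩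
        exact not_not.1 fun h => hy ((hQ y).2 h)
      exact (hQ x).1 hx (hker (hBE (v x) ⟨x, rfl⟩ hmem))
    · intro hx
      by_contra hPx
      exact hx (AddSubgroup.subset_closure ⟨v x, ⟨x, hPx, rfl⟩, rfl⟩)

theorem chainRank_supports_le {A : Type*} [AddCommGroup A] {l r n m : ℕ} (hr : 1 ≤ r) (hn : 1 ≤ n)
    {P : (Fin r → Bool) → Bool} {T : ℕ} {μ : Fin T → Fin r → ℕ} {coef : Fin T → A}
    (hμ : ∀ j, ∑ i, μ j i ≤ l)
    (hP : ∀ x : Fin r → Bool, P x = true ↔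
      ∑ j, (∏ i, (if x i then (1 : ℤ) else 0) ^ μ j i) • coef j ≠ 0)
    (t : Fin m → Fin r → Fin n) :
    chainRank (Finset.univ.image fun a : Fin n → Bool =>
      Finset.univ.filter fun j => P (fun k => a (t j k)) = true) ≤ 10 * n ^ l * r ^ (2 * l) := by
  obtain ⟨E, hE0, hE, V, hV⟩ := exists_zmod_subgroup hμ hP
  have : NeZero E := ⟨hE0⟩
  let N := {S : Finset (Fin n) // S.card ≤ l}
  let pull (j : Fin m) : (N → ZMod E) →+ ({S : Finset (Fin r) // S.card ≤ l} → ZMod E) :=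
    { toFun := fun g S => g ⟨S.1.image (t j), Finset.card_image_le.trans S.2⟩
      map_zero' := rfl
      map_add' := fun _ _ => rfl }
  have h1 := (hasChain_chainRank _).le_cardFactors (fun j => V.comap (pull j))
    (⊤ : AddSubgroup (N → ZMod E))
    (𝒞 := Finset.univ.image fun a : Fin n → Bool =>
      Finset.univ.filter fun j => P (fun k => a (t j k)) = true) (by
      intro s hs
      obtain ⟨a, -, rfl⟩ := Finset.mem_image.1 hs
      refine ⟨fun S => (multilinearMonomial a S.1 : ZMod E), AddSubgroup.mem_top _, fun j => ?_⟩
      rw [Finset.mem_filter, hV]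
      simp only [Finset.mem_univ, true_and, AddSubgroup.mem_comap, pull, AddMonoidHom.coe_mk,
        ZeroHom.coe_mk, multilinearMonomial_image])
  have hcard : Nat.card (⊤ : AddSubgroup (N → ZMod E)) = E ^ Fintype.card N := by
    rw [AddSubgroup.card_top, Nat.card_eq_fintype_card, Fintype.card_fun, ZMod.card]
  rw [hcard, ArithmeticFunction.cardFactors_pow] at h1
  have hN : Fintype.card N ≤ n ^ l + 1 := by simpa using card_finset_card_le (Fin n) l
  have hn' : 1 ≤ n ^ l := Nat.one_le_pow _ _ hn
  have hr' : 1 ≤ r ^ l := Nat.one_le_pow _ _ hr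
  calc _ ≤ Fintype.card N * ArithmeticFunction.cardFactors E := h1
    _ ≤ (n ^ l + 1) * ((r ^ l + 1) ^ 2 + 1) := Nat.mul_le_mul hN hE
    _ ≤ (2 * n ^ l) * (5 * (r ^ l) ^ 2) := Nat.mul_le_mul (by omega) (by nlinarith)
    _ = 10 * n ^ l * r ^ (2 * l) := by rw [← pow_mul, mul_comm l 2]; ring

end Predicate

section Assembly

theorem exists_merge_repetitions {ι τ : Type*} [Fintype ι] [DecidableEq ι] [Fintype τ]
    [DecidableEq τ] {w : ι → ℝ} (hw : ∀ j, 0 ≤ w j) (t : ι → τ) :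
    ∃ (J : Finset ι) (w' : ι → ℝ), (∀ j ∈ J, 0 < w' j) ∧ J.card ≤ Fintype.card τ ∧
      ∀ s : Finset ι, (∀ i j, t i = t j → i ∈ s → j ∈ s) →
        ∑ j ∈ s ∩ J, w' j = ∑ j ∈ s, w j := by
  rcases isEmpty_or_nonempty ι with hι | hι
  · refine ⟨∅, w, by simp, by simp, fun s _ => ?_⟩
    rw [Finset.eq_empty_of_isEmpty s]
    simp
  let g : ι → ι := fun j => Function.invFun t (t j)
  have hg : ∀ j, t (g j) = t j := fun j => Function.invFun_eq ⟨j, rfl⟩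
  have hgt : ∀ i j, t i = t j → g i = g j := fun i j h => congrArg (Function.invFun t) h
  let w' : ι → ℝ := fun j => ∑ i ∈ Finset.univ.filter (fun i => t i = t j), w i
  have hw' : ∀ j, 0 ≤ w' j := fun j => Finset.sum_nonneg fun i _ => hw i
  refine ⟨Finset.univ.filter fun j => g j = j ∧ 0 < w' j, w',
    fun j hj => (Finset.mem_filter.1 hj).2.2, ?_, fun s hs => ?_⟩
  · refine Finset.card_le_card_of_injOn t (fun _ _ => Finset.mem_univ _) fun i hi j hj hij => ?_
    have hi' := (Finset.mem_filter.1 hi).2.1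
    have hj' := (Finset.mem_filter.1 hj).2.1
    rw [← hi', ← hj', hgt i j hij]
  · have h1 : ∑ j ∈ s ∩ Finset.univ.filter (fun j => g j = j ∧ 0 < w' j), w' j =
        ∑ j ∈ s.filter (fun j => g j = j), w' j := by
      refine Finset.sum_subset (fun j hj => ?_) fun j hj hj' => ?_
      · simp only [Finset.mem_inter, Finset.mem_filter, Finset.mem_univ, true_and] at hj ⊢
        exact ⟨hj.1, hj.2.1⟩
      · simp only [Finset.mem_inter, Finset.mem_filter, Finset.mem_univ, true_and] at hj hj'
        exact le_antisymm (not_lt.1 fun h => hj' ⟨hj.1, hj.2, h⟩) (hw' j)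
    rw [h1, ← Finset.sum_fiberwise_of_maps_to (s := s) (t := s.filter fun j => g j = j) (g := g)
      (fun j hj => Finset.mem_filter.2 ⟨hs j (g j) (hg j).symm hj, hgt _ _ (hg j)⟩)]
    refine Finset.sum_congr rfl fun j hj => Finset.sum_congr ?_ fun _ _ => rfl
    obtain ⟨hjs, hgj⟩ := Finset.mem_filter.1 hj
    ext i
    simp only [Finset.mem_filter, Finset.mem_univ, true_and]
    constructor
    · intro h
      exact ⟨hs j i h.symm hjs, by rw [hgt i j h, hgj]⟩
    · rintro ⟨-, h⟩
      rw [← hg i, h]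

theorem logb_two_le_two_mul {x : ℝ} (hx : 0 < x) : Real.logb 2 x ≤ 2 * x := by
  rw [Real.logb, div_le_iff₀ (Real.log_pos one_lt_two)]
  nlinarith [Real.log_le_sub_one_of_pos hx, Real.log_two_gt_d9]

theorem logb_two_pow_div_le {n r : ℕ} {ε : ℝ} (hn : 1 ≤ n) (hr : 1 ≤ r) (hε : 0 < ε)
    (hε1 : ε < 1) :
    Real.logb 2 (2 * ((n ^ r : ℕ) : ℝ) / (ε / 3)) ≤ 7 * (2 * n * r / ε) := by
  have hn' : (1 : ℝ) ≤ n := by exact_mod_cast hn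
  have hr' : (1 : ℝ) ≤ r := by exact_mod_cast hr
  have hn0 : (0 : ℝ) < n := by linarith
  have h1 : Real.logb 2 (2 * ((n ^ r : ℕ) : ℝ) / (ε / 3)) =
      Real.logb 2 (6 / ε) + r * Real.logb 2 n := by
    rw [← Real.logb_pow, ← Real.logb_mul (by positivity) (by positivity)]
    congr 1
    push_cast
    field_simp
    norm_num
  have h2 := logb_two_le_two_mul (x := 6 / ε) (by positivity)
  have h3 := logb_two_le_two_mul hn0
  have h4 : 12 / ε ≤ 6 * (2 * n * r / ε) := by
    rw [← mul_div_assoc]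
    gcongr
    nlinarith
  have h5 : r * (2 * n) ≤ 2 * n * r / ε := by
    rw [le_div_iff₀ hε]
    nlinarith [mul_pos hn0 (by linarith : (0 : ℝ) < r)]
  have h6 : (2 : ℝ) * (6 / ε) = 12 / ε := by ring
  have h7 : (r : ℝ) * Real.logb 2 n ≤ r * (2 * n) := by gcongr
  rw [h1]
  linarith

theorem logb_two_sparsifier_size_le {n r l : ℕ} {ε s : ℝ} (hn : 1 ≤ n) (hr : 1 ≤ r) (hl : 1 ≤ l)
    (hε : 0 < ε) (hε1 : ε < 1) (hs1 : 1 ≤ s)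
    (hs : s ≤ max 1 (24577 * ((10 * n ^ l * r ^ (2 * l) : ℕ) : ℝ) *
      Real.logb 2 (2 * ((n ^ r : ℕ) : ℝ) / (ε / 3)) ^ 5 / (ε / 3) ^ 2)) :
    0 ≤ Real.logb 2 (2 * s / (ε / 3)) ∧
      Real.logb 2 (2 * s / (ε / 3)) ≤ 50 * (l * Real.logb 2 (2 * n * r / ε)) := by
  have hn' : (1 : ℝ) ≤ n := by exact_mod_cast hn
  have hr' : (1 : ℝ) ≤ r := by exact_mod_cast hr
  have hl' : (1 : ℝ) ≤ l := by exact_mod_cast hl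
  have hΛ := logb_two_pow_div_le hn hr hε hε1
  have hΛ0 : 0 ≤ Real.logb 2 (2 * ((n ^ r : ℕ) : ℝ) / (ε / 3)) := by
    refine Real.logb_nonneg one_lt_two ?_
    have : (1 : ℝ) ≤ ((n ^ r : ℕ) : ℝ) := by exact_mod_cast Nat.one_le_pow _ _ hn
    rw [le_div_iff₀ (by positivity)]
    linarith
  set X : ℝ := 2 * n * r / ε with hX
  have hnr : (1 : ℝ) ≤ n * r := one_le_mul_of_one_le_of_one_le hn' hr'
  have hX2 : 2 ≤ X := by
    rw [hX, le_div_iff₀ hε]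
    nlinarith
  have hXε : 1 / ε ≤ X := by
    rw [hX]
    gcongr
    nlinarith
  have hXn : (n : ℝ) ≤ X := by
    rw [hX, le_div_iff₀ hε]
    nlinarith
  have hXr : (r : ℝ) ≤ X := by
    rw [hX, le_div_iff₀ hε]
    nlinarith
  have hX1 : 1 ≤ X := by linarith
  have hbound : s ≤ 2 ^ 36 * X ^ (10 * l) := by
    refine hs.trans (max_le ?_ ?_)
    · have := one_le_pow₀ hX1 (n := 10 * l)
      linarith
    · calc _ = 24577 * (10 * (n : ℝ) ^ l * (r : ℝ) ^ (2 * l)) *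
              Real.logb 2 (2 * ((n ^ r : ℕ) : ℝ) / (ε / 3)) ^ 5 * (9 * (1 / ε) ^ 2) := by
            push_cast
            field_simp
            ring
        _ ≤ 24577 * (10 * X ^ l * X ^ (2 * l)) * (7 * X) ^ 5 * (9 * X ^ 2) := by gcongr
        _ = (24577 * 10 * 7 ^ 5 * 9) * X ^ (3 * l + 7) := by ring
        _ ≤ 2 ^ 36 * X ^ (10 * l) := by
            gcongr
            · norm_num
            · omega
  have hs0 : 0 < 2 * s / (ε / 3) := by positivity
  constructor
  · refine Real.logb_nonneg one_lt_two ?_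
    rw [le_div_iff₀ (by positivity)]
    linarith
  · have hL1 : 1 ≤ Real.logb 2 X := by
      rw [Real.le_logb_iff_rpow_le one_lt_two (by linarith), Real.rpow_one]
      exact hX2
    have h1 : 2 * s / (ε / 3) ≤ 2 ^ 39 * X ^ (11 * l) := by
      calc 2 * s / (ε / 3) = 6 * s * (1 / ε) := by field_simp; norm_num
        _ ≤ 6 * (2 ^ 36 * X ^ (10 * l)) * X := by gcongr
        _ = (6 * 2 ^ 36) * X ^ (10 * l + 1) := by ring
        _ ≤ 2 ^ 39 * X ^ (11 * l) := by
            gcongr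
            · norm_num
            · omega
    calc Real.logb 2 (2 * s / (ε / 3)) ≤ Real.logb 2 (2 ^ 39 * X ^ (11 * l)) :=
          Real.logb_le_logb_of_le one_lt_two hs0 h1
      _ = 39 + 11 * (l * Real.logb 2 X) := by
          rw [Real.logb_mul (by positivity) (by positivity), Real.logb_pow, Real.logb_pow,
            Real.logb_self_eq_one one_lt_two]
          push_cast
          ring
      _ ≤ 50 * (l * Real.logb 2 X) := by nlinarith

theorem sum_mul_ite_eq_sum_inter {ι : Type*} [Fintype ι] [DecidableEq ι] (S : Finset ι) (w : ι → ℝ)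
    (b : ι → Bool) :
    ∑ j ∈ S, w j * (if b j then 1 else 0) =
      ∑ j ∈ Finset.univ.filter (fun j => b j = true) ∩ S, w j := by
  rw [← Finset.filter_univ_mem S, ← Finset.filter_and, Finset.sum_filter, Finset.sum_filter]
  refine Finset.sum_congr rfl fun j _ => ?_
  by_cases h1 : j ∈ S <;> by_cases h2 : b j = true <;> simp [h1, h2]

end Assembly

/-- sparsifiers of size roughly n^ℓ for CSPs whose predicate is the
nonvanishing locus of a degree-ℓ polynomial over an Abelian group. A degree-ℓ
polynomial is a formal finite sum of monomials (given by exponent vectors `μ j`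
with total degree at most ℓ) with coefficients `coef j` in the group, evaluated at
{0,1}-points by letting the integer monomial value act on the coefficient. -/
theorem stmt_14 :
    ∃ K c : ℝ, 0 < K ∧ 0 < c ∧
      ∀ (A : Type) [AddCommGroup A], ∀ (l r : ℕ), 1 ≤ l → 1 ≤ r →
      ∀ P : (Fin r → Bool) → Bool,
        (∃ (T : ℕ) (μ : Fin T → Fin r → ℕ) (coef : Fin T → A),
          (∀ j, ∑ i, μ j i ≤ l) ∧
          ∀ x : Fin r → Bool,
            (P x = true ↔
              (∑ j, (∏ i, (if x i then (1 : ℤ) else 0) ^ μ j i) • coef j) ≠ 0)) →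
      ∀ ε : ℝ, 0 < ε → ε < 1 → ∀ n : ℕ, 1 ≤ n →
      ∀ (m : ℕ) (w : Fin m → ℝ) (t : Fin m → Fin r → Fin n), (∀ j, 0 ≤ w j) →
      ∃ (S : Finset (Fin m)) (w' : Fin m → ℝ),
        (∀ j ∈ S, 0 ≤ w' j) ∧
        (S.card : ℝ) ≤ K * (n : ℝ) ^ l * (r : ℝ) ^ (4 * l) *
          ((l : ℝ) * Real.logb 2 (2 * (n : ℝ) * (r : ℝ) / ε)) ^ c / ε ^ 2 ∧
        ∀ a : Fin n → Bool,
          (1 - ε) * cspVal P w t a ≤ cspValOn P S w' t a ∧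
          cspValOn P S w' t a ≤ (1 + ε) * cspVal P w t a := by
  refine ⟨24577 * 10 * 9 * 50 ^ 5, 5, by norm_num, by norm_num, ?_⟩
  rintro A _ l r hl hr P ⟨T, μ, coef, hμ, hP⟩ ε hε hε1 n hn m w t hw
  have hD := chainRank_supports_le hr hn hμ hP t
  have hnl : 1 ≤ n ^ l := Nat.one_le_pow _ _ hn
  have hrl : 1 ≤ r ^ (2 * l) := Nat.one_le_pow _ _ hr
  have hD1 : 1 ≤ 10 * n ^ l * r ^ (2 * l) := by nlinarith
  obtain ⟨J₀, w₀, hw₀, hJ₀, hsum₀⟩ := exists_merge_repetitions hw t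
  rw [Fintype.card_fun, Fintype.card_fin, Fintype.card_fin] at hJ₀
  obtain ⟨J₁, w₁, -, hw₁, hJ₁, happ₁⟩ := exists_family_sparsifier (ε := ε / 3) hw₀ hD hD1
    (Nat.one_le_pow _ _ hn) hJ₀ (by linarith) (by linarith)
  obtain ⟨J₂, w₂, -, hw₂, hJ₂, happ₂⟩ := exists_family_sparsifier (ε := ε / 3) hw₁ hD hD1
    (le_max_left 1 J₁.card) (le_max_right _ _) (by linarith) (by linarith)
  obtain ⟨hΛ0, hΛ⟩ := logb_two_sparsifier_size_le (s := ((max 1 J₁.card : ℕ) : ℝ)) hn hr hl hε hε1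
    (by exact_mod_cast le_max_left 1 J₁.card)
    (by rw [Nat.cast_max, Nat.cast_one]; exact max_le_max le_rfl hJ₁)
  refine ⟨J₂, w₂, fun j hj => (hw₂ j hj).le, hJ₂.trans ?_, fun a => ?_⟩
  · have hr' : (1 : ℝ) ≤ r := by exact_mod_cast hr
    calc _ = 24577 * (10 * (n : ℝ) ^ l * (r : ℝ) ^ (2 * l)) *
            Real.logb 2 (2 * ((max 1 J₁.card : ℕ) : ℝ) / (ε / 3)) ^ 5 / (ε / 3) ^ 2 := by
          push_cast
          rfl
      _ ≤ 24577 * (10 * (n : ℝ) ^ l * (r : ℝ) ^ (4 * l)) *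
            (50 * (l * Real.logb 2 (2 * n * r / ε))) ^ 5 / (ε / 3) ^ 2 := by
          gcongr
          · norm_num
      _ = _ := by
          rw [show (5 : ℝ) = ((5 : ℕ) : ℝ) by norm_num, Real.rpow_natCast]
          field_simp
          ring
  · have hval : cspVal P w t a =
        ∑ j ∈ Finset.univ.filter (fun j => P (fun k => a (t j k)) = true) ∩ J₀, w₀ j := by
      rw [hsum₀ _ fun i j hij hi => ?_]
      · rw [cspVal, sum_mul_ite_eq_sum_inter, Finset.inter_univ]
      · rw [Finset.mem_filter] at hi ⊢
        rw [← hij]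
        exact ⟨Finset.mem_univ _, hi.2⟩
    have hmem := Finset.mem_image_of_mem (fun a : Fin n → Bool =>
      Finset.univ.filter fun j => P (fun k => a (t j k)) = true) (Finset.mem_univ a)
    rw [hval, cspValOn, sum_mul_ite_eq_sum_inter]
    obtain ⟨h1, h2⟩ := happ₁ _ hmem
    obtain ⟨h3, h4⟩ := happ₂ _ hmem
    have hnn : 0 ≤ ∑ j ∈ Finset.univ.filter (fun j => P (fun k => a (t j k)) = true) ∩ J₀, w₀ j :=
      Finset.sum_nonneg fun j hj => (hw₀ j (Finset.mem_inter.1 hj).2).le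
    constructor
    · refine le_trans ?_ ((mul_le_mul_of_nonneg_left h1 (by linarith)).trans h3)
      rw [← mul_assoc]
      exact mul_le_mul_of_nonneg_right (by nlinarith) hnn
    · refine (h4.trans (mul_le_mul_of_nonneg_left h2 (by linarith))).trans ?_
      rw [← mul_assoc]
      exact mul_le_mul_of_nonneg_right (by nlinarith) hnn
end

section
/- For every integer r ≥ 1 there exist constants K > 0 and c > 0 (depending only on r) such that the following holds. Let P : {0,1}^r → {0,1} be a predicate whose number of satisfying assignments |P⁻¹(1)| is not equal to 1. Then for every ε ∈ (0,1), every n ≥ 1, and every instance Φ of CSP(P) on n variables, Φ admits an (ε, s)-sparsifier with s ≤ K·n^{r−1}·(log₂(2n/ε))^c / ε². -/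
/-- The sum over all sign patterns of the exponential moment of a signed sum. -/
theorem sum_exp_signed_sum_le {ι : Type*} [Fintype ι] [DecidableEq ι] (X : Finset ι) (l : ℝ) :
    ∑ σ : ι → Bool, Real.exp (l * ∑ j ∈ X, if σ j then (1 : ℝ) else -1) ≤
      2 ^ Fintype.card ι * Real.exp (l ^ 2 * X.card / 2) := by
  have h1 : ∀ σ : ι → Bool, Real.exp (l * ∑ j ∈ X, if σ j then (1 : ℝ) else -1) =
      ∏ j : ι, if j ∈ X then Real.exp (l * if σ j then (1 : ℝ) else -1) else 1 := by
    intro σ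
    rw [Finset.mul_sum, Real.exp_sum, Finset.prod_ite_mem, Finset.univ_inter]
  have h2 : ∑ σ : ι → Bool, ∏ j : ι,
      (if j ∈ X then Real.exp (l * if σ j then (1 : ℝ) else -1) else 1) =
      ∏ j : ι, ∑ b : Bool, (if j ∈ X then Real.exp (l * if b then (1 : ℝ) else -1) else 1) := by
    rw [Finset.prod_univ_sum, Fintype.piFinset_univ]
  have h3 : ∀ j : ι, ∑ b : Bool,
      (if j ∈ X then Real.exp (l * if b then (1 : ℝ) else -1) else 1) ≤
      2 * if j ∈ X then Real.exp (l ^ 2 / 2) else 1 := by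
    intro j
    split_ifs
    · have := Real.cosh_le_exp_half_sq l
      rw [Real.cosh_eq] at this
      simp only [Fintype.sum_bool, if_true, mul_one, Bool.false_eq_true, if_false, mul_neg]
      linarith
    · norm_num
  calc _ = ∏ j : ι, ∑ b : Bool,
        (if j ∈ X then Real.exp (l * if b then (1 : ℝ) else -1) else 1) := by
        rw [← h2]; exact Finset.sum_congr rfl fun σ _ => h1 σ
    _ ≤ ∏ j : ι, (2 * if j ∈ X then Real.exp (l ^ 2 / 2) else 1) := by
        refine Finset.prod_le_prod (fun j _ => Finset.sum_nonneg fun b _ => ?_) fun j _ => h3 j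
        split_ifs <;> positivity
    _ = _ := by
        rw [Finset.prod_mul_distrib, Finset.prod_const, Finset.prod_ite_mem, Finset.univ_inter,
          Finset.prod_const, ← Real.exp_nat_mul, Finset.card_univ]
        congr 2; ring

/-- A Hoeffding-type union bound: some sign pattern has small discrepancy on every listed set. -/
theorem exists_signs {ι E : Type*} [Fintype ι] [DecidableEq ι] (s : Finset E)
    (X : E → Finset ι) (M : E → ℝ) {ε : ℝ} (hε : 0 < ε) (hM : ∀ e ∈ s, ((X e).card : ℝ) ≤ M e)
    (hsum : ∑ e ∈ s, 2 * Real.exp (-(ε ^ 2 * M e / 2)) < 1) :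
    ∃ σ : ι → Bool, ∀ e ∈ s, |∑ j ∈ X e, if σ j then (1 : ℝ) else -1| ≤ ε * M e := by
  by_contra! hcon
  set Y : (ι → Bool) → E → ℝ := fun σ e => ∑ j ∈ X e, if σ j then (1 : ℝ) else -1 with hY
  have hlow : ∀ σ : ι → Bool, 1 ≤ ∑ e ∈ s,
      (Real.exp (ε * Y σ e) + Real.exp (-ε * Y σ e)) * Real.exp (-(ε ^ 2 * M e)) := by
    intro σ
    obtain ⟨e, he, hlt⟩ := hcon σ
    refine le_trans ?_ (Finset.single_le_sum (f := fun e =>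
      (Real.exp (ε * Y σ e) + Real.exp (-ε * Y σ e)) * Real.exp (-(ε ^ 2 * M e)))
      (fun e _ => by positivity) he)
    have hb : Real.exp (ε ^ 2 * M e) ≤ Real.exp (ε * Y σ e) + Real.exp (-ε * Y σ e) := by
      rcases lt_abs.1 hlt with h | h
      · have : Real.exp (ε ^ 2 * M e) ≤ Real.exp (ε * Y σ e) :=
          Real.exp_le_exp.2 (by simp only [hY]; nlinarith)
        linarith [Real.exp_pos (-ε * Y σ e)]
      · have : Real.exp (ε ^ 2 * M e) ≤ Real.exp (-ε * Y σ e) :=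
          Real.exp_le_exp.2 (by simp only [hY]; nlinarith)
        linarith [Real.exp_pos (ε * Y σ e)]
    calc (1 : ℝ) = Real.exp (ε ^ 2 * M e) * Real.exp (-(ε ^ 2 * M e)) := by
          rw [← Real.exp_add]; simp
      _ ≤ _ := mul_le_mul_of_nonneg_right hb (Real.exp_pos _).le
  have hup : ∑ σ : ι → Bool, ∑ e ∈ s,
      (Real.exp (ε * Y σ e) + Real.exp (-ε * Y σ e)) * Real.exp (-(ε ^ 2 * M e)) ≤
      2 ^ Fintype.card ι * ∑ e ∈ s, 2 * Real.exp (-(ε ^ 2 * M e / 2)) := by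
    rw [Finset.sum_comm, Finset.mul_sum]
    refine Finset.sum_le_sum fun e he => ?_
    rw [← Finset.sum_mul, Finset.sum_add_distrib]
    have h1 := sum_exp_signed_sum_le (X e) ε
    have h2 := sum_exp_signed_sum_le (X e) (-ε)
    have h3 : Real.exp (ε ^ 2 * (X e).card / 2) ≤ Real.exp (ε ^ 2 * M e / 2) :=
      Real.exp_le_exp.2 (by have := hM e he; gcongr)
    rw [neg_sq] at h2
    have h4 : (2 : ℝ) ^ Fintype.card ι * Real.exp (ε ^ 2 * (X e).card / 2) ≤
      2 ^ Fintype.card ι * Real.exp (ε ^ 2 * M e / 2) := by gcongr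
    calc _ ≤ (2 * (2 ^ Fintype.card ι * Real.exp (ε ^ 2 * M e / 2))) *
          Real.exp (-(ε ^ 2 * M e)) := by
          refine mul_le_mul_of_nonneg_right ?_ (Real.exp_pos _).le
          simp only [hY]; linarith
      _ = 2 ^ Fintype.card ι * (2 * (Real.exp (ε ^ 2 * M e / 2) *
          Real.exp (-(ε ^ 2 * M e)))) := by ring
      _ = _ := by rw [← Real.exp_add]; congr 3; ring
  have hcard : (2 : ℝ) ^ Fintype.card ι ≤ ∑ σ : ι → Bool, ∑ e ∈ s,
      (Real.exp (ε * Y σ e) + Real.exp (-ε * Y σ e)) * Real.exp (-(ε ^ 2 * M e)) := by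
    calc (2 : ℝ) ^ Fintype.card ι = ∑ σ : ι → Bool, (1 : ℝ) := by simp
      _ ≤ _ := Finset.sum_le_sum fun σ _ => hlow σ
  have hpos : (0 : ℝ) < 2 ^ Fintype.card ι := by positivity
  nlinarith

/-- Layer-cake positivity: if all upper-level sums of `h` are nonnegative then so is the
weighted sum. -/
theorem sum_mul_nonneg_of_level_sums_nonneg {ι : Type*} (h : ι → ℝ) (J : Finset ι) (w : ι → ℝ)
    (hw : ∀ j ∈ J, 0 ≤ w j) (hh : ∀ i ∈ J, 0 ≤ ∑ j ∈ J with w i ≤ w j, h j) :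
    0 ≤ ∑ j ∈ J, w j * h j := by
  classical
  induction J using Finset.strongInduction generalizing w with
  | H J ih =>
    rcases J.eq_empty_or_nonempty with rfl | hne
    · simp
    obtain ⟨i, hi, hmin⟩ := J.exists_min_image w hne
    have hfull : J.filter (fun j => w i ≤ w j) = J := Finset.filter_true_of_mem hmin
    have hJ := hh i hi
    rw [hfull] at hJ
    have hrec := ih (J.filter fun j => w i < w j)
      (Finset.filter_ssubset.2 ⟨i, hi, lt_irrefl _⟩) (fun j => w j - w i)
      (fun j hj => by linarith [(Finset.mem_filter.1 hj).2]) (by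
        intro k hk
        rw [Finset.mem_filter] at hk
        have : (J.filter fun j => w i < w j).filter (fun j => w k - w i ≤ w j - w i) =
            J.filter fun j => w k ≤ w j := by
          ext j
          simp only [Finset.mem_filter, sub_le_sub_iff_right]
          exact ⟨fun h => ⟨h.1.1, h.2⟩, fun h => ⟨⟨h.1, hk.2.trans_le h.2⟩, h.2⟩⟩
        rw [this]
        exact hh k hk.1)
    have hsplit : ∑ j ∈ J with w i < w j, (w j - w i) * h j = ∑ j ∈ J, (w j - w i) * h j := by
      refine Finset.sum_subset (Finset.filter_subset _ _) fun j hj hn => ?_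
      have : w j = w i := le_antisymm
        (not_lt.1 fun hlt => hn (Finset.mem_filter.2 ⟨hj, hlt⟩)) (hmin j hj)
      simp [this]
    rw [hsplit] at hrec
    have : ∑ j ∈ J, w j * h j = w i * ∑ j ∈ J, h j + ∑ j ∈ J, (w j - w i) * h j := by
      rw [Finset.mul_sum, ← Finset.sum_add_distrib]
      exact Finset.sum_congr rfl fun j _ => by ring
    rw [this]
    exact add_nonneg (mul_nonneg (hw i hi) hJ) hrec

/-- Greedy packing of `t` disjoint independent sets: every leftover vector is spanned, in each of
them, by members of at least its own weight. -/
theorem exists_greedy_packing {ι F V : Type*} [DecidableEq ι] [Field F] [AddCommGroup V]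
    [Module F V] (v : ι → V) (w : ι → ℝ) (t : ℕ) (J : Finset ι) :
    ∃ B : Fin t → Finset ι, (∀ s, B s ⊆ J) ∧ (∀ s s', s ≠ s' → Disjoint (B s) (B s')) ∧
      (∀ s, LinearIndepOn F v (B s : Set ι)) ∧
      ∀ j ∈ J, (∀ s, j ∉ B s) →
        ∀ s, v j ∈ Submodule.span F (v '' {i | i ∈ B s ∧ w j ≤ w i}) := by
  induction J using Finset.induction_on_min_value w with
  | empty => exact ⟨fun _ => ∅, by simp, by simp, by simp, by simp⟩
  | insert a J ha hmin ih =>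
    obtain ⟨B, hsub, hdis, hind, hspan⟩ := ih
    by_cases hcase : ∃ s, v a ∉ Submodule.span F (v '' (B s : Set ι))
    · obtain ⟨s₀, hs₀⟩ := hcase
      have hmono : ∀ s, B s ⊆ Function.update B s₀ (insert a (B s₀)) s := by
        intro s
        by_cases h : s = s₀
        · subst h; simp
        · simp [h]
      have haB : ∀ s, a ∉ B s := fun s h => ha (hsub s h)
      refine ⟨Function.update B s₀ (insert a (B s₀)), ?_, ?_, ?_, ?_⟩
      · intro s
        by_cases h : s = s₀
        · subst h
          simpa using Finset.insert_subset_insert a (hsub s)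
        · simpa [h] using (hsub s).trans (Finset.subset_insert a J)
      · intro s s' hne
        by_cases h : s = s₀
        · subst h
          simpa [hne.symm, Finset.disjoint_insert_left] using And.intro (haB s') (hdis s s' hne)
        · by_cases h' : s' = s₀
          · subst h'
            simpa [h, Finset.disjoint_insert_right] using And.intro (haB s) (hdis s s' hne)
          · simpa [h, h'] using hdis s s' hne
      · intro s
        by_cases h : s = s₀
        · subst h
          simpa using (hind s).insert hs₀
        · simpa [h] using hind s
      · intro j hj hjB s
        have hja : j ≠ a := by
          rintro rfl
          exact hjB s₀ (by simp)
        refine Submodule.span_mono (Set.image_mono fun i hi => And.intro (hmono s hi.1) hi.2)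
          (hspan j (Finset.mem_of_mem_insert_of_ne hj hja) (fun s h => hjB s (hmono s h)) s)
    · push Not at hcase
      refine ⟨B, fun s => (hsub s).trans (Finset.subset_insert a J), hdis, hind, ?_⟩
      intro j hj hjB s
      rcases Finset.mem_insert.1 hj with rfl | hj
      · exact Submodule.span_mono
          (Set.image_mono fun i hi => And.intro hi (hmin i (hsub s hi))) (hcase s)
      · exact hspan j hj hjB s

/-- The generating function of Hamming weights of vectors supported on `B`, without the zero
vector. -/
theorem sum_pow_support_le {ι F : Type*} [Fintype ι] [DecidableEq ι] [Field F] [Fintype F]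
    [DecidableEq F] (B : Finset ι) {q : ℝ} (hq : 0 ≤ q) :
    ∑ y : ι → F with y ≠ 0 ∧ ∀ j, y j ≠ 0 → j ∈ B,
      q ^ (Finset.univ.filter fun j => y j ≠ 0).card ≤
      (1 + Fintype.card F * q) ^ B.card - 1 := by
  have h1 : ∑ y ∈ Fintype.piFinset (fun j => if j ∈ B then (Finset.univ : Finset F) else {0}),
      q ^ (Finset.univ.filter fun j => y j ≠ 0).card ≤ (1 + Fintype.card F * q) ^ B.card := by
    have h2 : ∀ y : ι → F, q ^ (Finset.univ.filter fun j => y j ≠ 0).card =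
        ∏ j, if y j ≠ 0 then q else 1 := by
      intro y
      rw [← Finset.prod_filter, Finset.prod_const]
    simp only [h2]
    rw [← Finset.prod_univ_sum (f := fun _ (x : F) => if x ≠ 0 then q else 1)]
    have h3 : ∀ j, ∑ x ∈ (if j ∈ B then (Finset.univ : Finset F) else {0}),
        (if x ≠ 0 then q else 1) ≤ if j ∈ B then 1 + Fintype.card F * q else 1 := by
      intro j
      split_ifs
      · calc ∑ x : F, (if x ≠ 0 then q else 1) ≤ ∑ x : F, ((if x = 0 then 1 else 0) + q) := by
              refine Finset.sum_le_sum fun x _ => ?_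
              by_cases hx : x = 0 <;> simp [hx, hq]
          _ = _ := by simp [Finset.sum_add_distrib]
      · simp
    calc _ ≤ ∏ j, (if j ∈ B then 1 + Fintype.card F * q else 1) := by
          refine Finset.prod_le_prod (fun j _ => Finset.sum_nonneg fun x _ => ?_) fun j _ => h3 j
          split_ifs <;> first | exact hq | exact zero_le_one
      _ = _ := by rw [Finset.prod_ite_mem, Finset.univ_inter, Finset.prod_const]
  have h0 : (0 : ι → F) ∈
      Fintype.piFinset (fun j => if j ∈ B then (Finset.univ : Finset F) else {0}) := by
    rw [Fintype.mem_piFinset]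
    intro j
    split_ifs <;> simp
  rw [← Finset.add_sum_erase _ _ h0] at h1
  have h4 : ∑ y : ι → F with y ≠ 0 ∧ ∀ j, y j ≠ 0 → j ∈ B,
      q ^ (Finset.univ.filter fun j => y j ≠ 0).card ≤
      ∑ y ∈ (Fintype.piFinset
        (fun j => if j ∈ B then (Finset.univ : Finset F) else {0})).erase 0,
      q ^ (Finset.univ.filter fun j => y j ≠ 0).card := by
    refine Finset.sum_le_sum_of_subset_of_nonneg ?_ fun _ _ _ => by positivity
    intro y hy
    simp only [Finset.mem_filter, Finset.mem_univ, true_and] at hy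
    rw [Finset.mem_erase, Fintype.mem_piFinset]
    refine ⟨hy.1, fun j => ?_⟩
    split_ifs with hj
    · simp
    · simpa using fun h => hj (hy.2 j h)
  simp only [Pi.zero_apply, ne_eq, not_true_eq_false, Finset.filter_false, Finset.card_empty,
    pow_zero] at h1
  simp only [ne_eq] at h4 ⊢
  linarith

/-- Comparing all upper-level sums compares the weighted sums. -/
theorem abs_sum_mul_le_of_level_sums {ι : Type*} [DecidableEq ι] {J T : Finset ι}
    {w : ι → ℝ} (hw : ∀ j ∈ J, 0 ≤ w j) (f g : ι → ℝ) {ε : ℝ}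
    (h : ∀ i ∈ J, |∑ j ∈ J \ T with w i ≤ w j, g j| ≤ ε * ∑ j ∈ J with w i ≤ w j, f j) :
    |∑ j ∈ J \ T, w j * g j| ≤ ε * ∑ j ∈ J, w j * f j := by
  have hside : ∀ c : ℝ, |c| = 1 →
      c * ∑ j ∈ J \ T, w j * g j ≤ ε * ∑ j ∈ J, w j * f j := by
    intro c hc
    have h0 := sum_mul_nonneg_of_level_sums_nonneg
      (fun j => ε * f j - c * if j ∈ T then 0 else g j) J w hw (by
        intro i hi
        rw [Finset.sum_sub_distrib, ← Finset.mul_sum, ← Finset.mul_sum]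
        have h1 := h i hi
        have h2 : ∑ j ∈ J with w i ≤ w j, (if j ∈ T then 0 else g j) =
            ∑ j ∈ J \ T with w i ≤ w j, g j := by
          rw [Finset.sdiff_eq_filter, Finset.filter_filter, Finset.sum_filter, Finset.sum_filter]
          refine Finset.sum_congr rfl fun j _ => ?_
          by_cases h1 : w i ≤ w j <;> by_cases h2 : j ∈ T <;> simp [h1, h2]
        rw [h2]
        have h3 := le_abs_self (c * ∑ j ∈ J \ T with w i ≤ w j, g j)
        rw [abs_mul, hc, one_mul] at h3
        linarith)
    have h4 : ∑ j ∈ J, w j * (ε * f j - c * if j ∈ T then 0 else g j) =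
        ε * (∑ j ∈ J, w j * f j) - c * ∑ j ∈ J \ T, w j * g j := by
      rw [Finset.sdiff_eq_filter, Finset.sum_filter, Finset.mul_sum, Finset.mul_sum,
        ← Finset.sum_sub_distrib]
      refine Finset.sum_congr rfl fun j _ => ?_
      by_cases h2 : j ∈ T <;> simp only [h2, not_true_eq_false, not_false_eq_true, if_true,
        if_false] <;> ring
    rw [h4] at h0
    exact sub_nonneg.1 h0
  refine abs_le'.2 ⟨?_, ?_⟩
  · simpa using hside 1 (by simp)
  · simpa using hside (-1) (by simp)

set_option maxHeartbeats 1000000 in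
/-- Signs of low discrepancy, simultaneously for all linear functionals, on all but few vectors. -/
theorem exists_low_discrepancy {ι F V : Type*} [Fintype ι] [DecidableEq ι] [Field F] [Fintype F]
    [DecidableEq F] [AddCommGroup V] [Module F V] (v : ι → V) {D : ℕ}
    (hD : ∀ B : Finset ι, LinearIndepOn F v (B : Set ι) → B.card ≤ D) {ε : ℝ} (hε : 0 < ε)
    {t : ℕ} (ht : 0 < t)
    (hsmall : Fintype.card ι * (t * (2 *
      ((1 + Fintype.card F * Real.exp (-(ε ^ 2 * t / 2))) ^ D - 1))) < 1)
    (J : Finset ι) (w : ι → ℝ) (hw : ∀ j ∈ J, 0 ≤ w j) :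
    ∃ T ⊆ J, T.card ≤ t * D ∧ ∃ σ : ι → Bool, ∀ φ : V →ₗ[F] F,
      |∑ j ∈ J \ T, w j * ((if φ (v j) = 0 then 0 else 1) * if σ j then 1 else -1)| ≤
        ε * ∑ j ∈ J, w j * if φ (v j) = 0 then 0 else 1 := by
  classical
  obtain ⟨B, hsub, hdis, hind, hspan⟩ := exists_greedy_packing (F := F) v w t J
  have hTsub : Finset.univ.biUnion B ⊆ J := Finset.biUnion_subset.2 fun s _ => hsub s
  have hTcard : (Finset.univ.biUnion B).card ≤ t * D := by
    simpa using Finset.card_biUnion_le_card_mul Finset.univ B D fun s _ => hD _ (hind s)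
  generalize hT : Finset.univ.biUnion B = T at hTsub hTcard
  refine ⟨T, hTsub, hTcard, ?_⟩
  have hnT : ∀ j ∈ J \ T, ∀ s, v j ∈ Submodule.span F (v '' {i | i ∈ B s ∧ w j ≤ w i}) := by
    intro j hj
    rw [Finset.mem_sdiff, ← hT] at hj
    exact hspan j hj.1 fun s hs => hj.2 (Finset.mem_biUnion.2 ⟨s, Finset.mem_univ _, hs⟩)
  have hagree : ∀ (i : ι) (s : Fin t) (φ ψ : V →ₗ[F] F),
      (∀ j ∈ B s, w i ≤ w j → φ (v j) = ψ (v j)) →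
      ∀ j ∈ J \ T, w i ≤ w j → φ (v j) = ψ (v j) := by
    intro i s φ ψ h j hj hij
    refine LinearMap.eqOn_span (s := v '' {k | k ∈ B s ∧ w j ≤ w k}) ?_ (hnT j hj s)
    rintro _ ⟨k, hk, rfl⟩
    exact h k hk.1 (hij.trans hk.2)
  let ext : ι × Fin t × (ι → F) → (V →ₗ[F] F) := fun e =>
    if h : ∃ φ : V →ₗ[F] F, ∀ j ∈ B e.2.1, w e.1 ≤ w j → φ (v j) = e.2.2 j then h.choose else 0
  have hext : ∀ e : ι × Fin t × (ι → F), ∀ φ : V →ₗ[F] F,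
      (∀ j ∈ B e.2.1, w e.1 ≤ w j → φ (v j) = e.2.2 j) →
      ∀ j ∈ B e.2.1, w e.1 ≤ w j → ext e (v j) = e.2.2 j := by
    intro e φ hφ
    have h : ∃ φ : V →ₗ[F] F, ∀ j ∈ B e.2.1, w e.1 ≤ w j → φ (v j) = e.2.2 j := ⟨φ, hφ⟩
    simp only [ext, dif_pos h]
    exact h.choose_spec
  let X : ι × Fin t × (ι → F) → Finset ι := fun e =>
    (J \ T).filter fun j => w e.1 ≤ w j ∧ ext e (v j) ≠ 0
  let supp : (ι → F) → Finset ι := fun y => Finset.univ.filter fun j => y j ≠ 0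
  let M : ι × Fin t × (ι → F) → ℝ := fun e => max ((X e).card : ℝ) (t * (supp e.2.2).card)
  obtain ⟨σ, hσ⟩ := exists_signs (Finset.univ.filter fun e : ι × Fin t × (ι → F) =>
      e.2.2 ≠ 0 ∧ ∀ j, e.2.2 j ≠ 0 → j ∈ B e.2.1) X M hε (fun e _ => le_max_left _ _) (by
    refine lt_of_le_of_lt ?_ hsmall
    set q := Real.exp (-(ε ^ 2 * t / 2)) with hq
    have hterm : ∀ e : ι × Fin t × (ι → F),
        2 * Real.exp (-(ε ^ 2 * M e / 2)) ≤ 2 * q ^ (supp e.2.2).card := by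
      intro e
      rw [hq, ← Real.exp_nat_mul]
      have : (t : ℝ) * (supp e.2.2).card ≤ M e := le_max_right _ _
      have h2 := mul_le_mul_of_nonneg_left this (sq_nonneg ε)
      gcongr
      linarith
    refine (Finset.sum_le_sum fun e _ => hterm e).trans ?_
    rw [Finset.sum_filter, Fintype.sum_prod_type]
    have hin : ∀ (i : ι) (s : Fin t), (∑ y : ι → F, if y ≠ 0 ∧ ∀ j, y j ≠ 0 → j ∈ B s then
        2 * q ^ (supp y).card else 0) ≤ 2 * ((1 + Fintype.card F * q) ^ D - 1) := by
      intro i s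
      rw [← Finset.sum_filter, ← Finset.mul_sum]
      have h1 := sum_pow_support_le (F := F) (B s) (Real.exp_pos (-(ε ^ 2 * t / 2))).le
      have h2 : (1 + Fintype.card F * q) ^ (B s).card ≤ (1 + Fintype.card F * q) ^ D :=
        pow_le_pow_right₀ (le_add_of_nonneg_right
          (mul_nonneg (Nat.cast_nonneg _) (Real.exp_pos _).le)) (hD _ (hind s))
      linarith
    calc _ ≤ ∑ i : ι, ∑ s : Fin t, 2 * ((1 + Fintype.card F * q) ^ D - 1) := by
          refine Finset.sum_le_sum fun i _ => ?_
          rw [Fintype.sum_prod_type]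
          exact Finset.sum_le_sum fun s _ => hin i s
      _ = _ := by simp)
  refine ⟨σ, fun φ => ?_⟩
  have hlevel : ∀ i ∈ J, |∑ j ∈ J \ T with w i ≤ w j,
      ((if φ (v j) = 0 then 0 else 1) * if σ j then (1 : ℝ) else -1)| ≤
      ε * ∑ j ∈ J with w i ≤ w j, if φ (v j) = 0 then (0 : ℝ) else 1 := by
    intro i hi
    set N := J.filter fun j => w i ≤ w j ∧ φ (v j) ≠ 0 with hN
    have hNsum : ∑ j ∈ J with w i ≤ w j, (if φ (v j) = 0 then (0 : ℝ) else 1) = N.card := by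
      rw [hN, Finset.card_filter, Finset.sum_filter]
      push_cast
      refine Finset.sum_congr rfl fun j _ => ?_
      by_cases h1 : w i ≤ w j <;> by_cases h2 : φ (v j) = 0 <;> simp [h1, h2]
    have hRsum : ∑ j ∈ J \ T with w i ≤ w j,
        ((if φ (v j) = 0 then 0 else 1) * if σ j then (1 : ℝ) else -1) =
        ∑ j ∈ (J \ T).filter (fun j => w i ≤ w j ∧ φ (v j) ≠ 0),
          if σ j then (1 : ℝ) else -1 := by
      rw [Finset.sum_filter, Finset.sum_filter]
      refine Finset.sum_congr rfl fun j _ => ?_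
      by_cases h1 : w i ≤ w j <;> by_cases h2 : φ (v j) = 0 <;> simp [h1, h2]
    rw [hNsum, hRsum]
    obtain ⟨s, hs⟩ : ∃ s : Fin t, t * (N ∩ B s).card ≤ N.card := by
      by_contra! hcon
      have h1 : ∑ s : Fin t, (N ∩ B s).card ≤ N.card := by
        rw [← Finset.card_biUnion fun s _ s' _ hne =>
          (hdis s s' hne).mono Finset.inter_subset_right Finset.inter_subset_right]
        exact Finset.card_le_card (Finset.biUnion_subset.2 fun s _ => Finset.inter_subset_left)
      have : Nonempty (Fin t) := ⟨⟨0, ht⟩⟩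
      have h2 : ∑ _s : Fin t, N.card < ∑ s : Fin t, t * (N ∩ B s).card :=
        Finset.sum_lt_sum_of_nonempty Finset.univ_nonempty fun s _ => hcon s
      rw [← Finset.mul_sum, Finset.sum_const, Finset.card_univ, Fintype.card_fin,
        smul_eq_mul] at h2
      exact absurd (Nat.lt_of_mul_lt_mul_left h2) (not_lt.2 h1)
    let y : ι → F := fun j => if j ∈ N ∩ B s then φ (v j) else 0
    have hyB : ∀ j ∈ B s, w i ≤ w j → φ (v j) = y j := by
      intro j hj hij
      by_cases h : φ (v j) = 0
      · simp [y, h]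
      · have : j ∈ N ∩ B s := by simp [hN, hsub s hj, hij, h, hj]
        simp only [y, if_pos this]
    have hsupp : supp y = N ∩ B s := by
      ext j
      simp only [supp, y, Finset.mem_filter, Finset.mem_univ, true_and, ne_eq, ite_eq_right_iff,
        Classical.not_imp]
      refine ⟨fun h => h.1, fun h => ⟨h, ?_⟩⟩
      exact (Finset.mem_filter.1 (Finset.mem_inter.1 h).1).2.2
    have hX : (J \ T).filter (fun j => w i ≤ w j ∧ φ (v j) ≠ 0) = X (i, s, y) := by
      refine Finset.filter_congr fun j hj => and_congr_right fun hij => ?_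
      rw [hagree i s φ (ext (i, s, y)) (fun k hk hik =>
        (hyB k hk hik).trans (hext (i, s, y) φ hyB k hk hik).symm) j hj hij]
    by_cases hy0 : y = 0
    · have hz : (J \ T).filter (fun j => w i ≤ w j ∧ φ (v j) ≠ 0) = ∅ := by
        refine Finset.filter_eq_empty_iff.2 fun {j} hj h => h.2 ?_
        exact hagree i s φ 0 (fun k hk hik => (hyB k hk hik).trans (congrFun hy0 k)) j hj h.1
      rw [hz, Finset.sum_empty, abs_zero]
      exact mul_nonneg hε.le (Nat.cast_nonneg _)
    · have hmem := hσ (i, s, y) (Finset.mem_filter.2 ⟨Finset.mem_univ _, hy0, fun j hj => by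
        have : j ∈ supp y := Finset.mem_filter.2 ⟨Finset.mem_univ _, hj⟩
        rw [hsupp] at this
        exact (Finset.mem_inter.1 this).2⟩)
      rw [hX]
      refine hmem.trans (mul_le_mul_of_nonneg_left (max_le ?_ ?_) hε.le)
      · rw [← hX]
        exact_mod_cast Finset.card_le_card
          (Finset.filter_subset_filter _ Finset.sdiff_subset)
      · simp only [hsupp]
        exact_mod_cast hs
  exact abs_sum_mul_le_of_level_sums hw _ _ hlevel

/-- One sparsification step: up to `t * D` vectors, half of the support is discarded. -/
theorem exists_half_sparsifier {ι F V : Type*} [Fintype ι] [DecidableEq ι] [Field F] [Fintype F]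
    [DecidableEq F] [AddCommGroup V] [Module F V] (v : ι → V) {D : ℕ}
    (hD : ∀ B : Finset ι, LinearIndepOn F v (B : Set ι) → B.card ≤ D) {ε : ℝ} (hε : 0 < ε)
    {t : ℕ} (ht : 0 < t)
    (hsmall : Fintype.card ι * (t * (2 *
      ((1 + Fintype.card F * Real.exp (-(ε ^ 2 * t / 2))) ^ D - 1))) < 1)
    (J : Finset ι) (w : ι → ℝ) (hw : ∀ j ∈ J, 0 ≤ w j) :
    ∃ S ⊆ J, ∃ w' : ι → ℝ, (∀ j ∈ S, 0 ≤ w' j) ∧ 2 * S.card ≤ t * D + J.card ∧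
      ∀ φ : V →ₗ[F] F,
      |∑ j ∈ S, (w' j * if φ (v j) = 0 then 0 else 1) -
        ∑ j ∈ J, (w j * if φ (v j) = 0 then 0 else 1)| ≤
        ε * ∑ j ∈ J, w j * if φ (v j) = 0 then 0 else 1 := by
  obtain ⟨T, hTJ, hT, σ, hσ⟩ := exists_low_discrepancy v hD hε ht hsmall J w hw
  obtain ⟨b, hb⟩ : ∃ b : Bool, 2 * ((J \ T).filter fun j => σ j = b).card ≤ (J \ T).card := by
    have h := Finset.card_filter_add_card_filter_not (s := J \ T) (fun j => σ j = true)
    simp only [Bool.not_eq_true] at h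
    by_cases h1 : 2 * ((J \ T).filter fun j => σ j = true).card ≤ (J \ T).card
    · exact ⟨true, h1⟩
    · exact ⟨false, by omega⟩
  have hdis : Disjoint T ((J \ T).filter fun j => σ j = b) :=
    Finset.disjoint_sdiff.mono_right (Finset.filter_subset _ _)
  refine ⟨T ∪ (J \ T).filter fun j => σ j = b,
    Finset.union_subset hTJ ((Finset.filter_subset _ _).trans Finset.sdiff_subset),
    fun j => if j ∈ T then w j else 2 * w j, ?_, ?_, fun φ => ?_⟩
  · intro j hj
    have hjJ : j ∈ J := by
      rcases Finset.mem_union.1 hj with h | h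
      · exact hTJ h
      · exact (Finset.mem_sdiff.1 (Finset.mem_filter.1 h).1).1
    have := hw j hjJ
    dsimp only
    split_ifs <;> linarith
  · have h1 := Finset.card_sdiff_add_card_eq_card hTJ
    rw [Finset.card_union_of_disjoint hdis]
    omega
  · refine le_trans (le_of_eq ?_) (hσ φ)
    rw [Finset.sum_union hdis, ← Finset.sum_sdiff hTJ, Finset.sum_filter]
    have h1 : ∑ j ∈ T, ((if j ∈ T then w j else 2 * w j) * if φ (v j) = 0 then 0 else 1) =
        ∑ j ∈ T, w j * if φ (v j) = 0 then 0 else 1 :=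
      Finset.sum_congr rfl fun j hj => by rw [if_pos hj]
    rw [h1, add_comm, add_sub_add_right_eq_sub, ← Finset.sum_sub_distrib]
    have h2 : ∀ j ∈ J \ T, ((if σ j = b then
        (if j ∈ T then w j else 2 * w j) * (if φ (v j) = 0 then 0 else 1) else 0) -
        w j * if φ (v j) = 0 then 0 else 1) = (if b then 1 else -1) *
        (w j * ((if φ (v j) = 0 then 0 else 1) * if σ j then 1 else -1)) := by
      intro j hj
      rw [if_neg (Finset.mem_sdiff.1 hj).2]
      by_cases h0 : φ (v j) = 0
      · simp [h0]
      · cases b <;> cases h : σ j <;> simp [h0] <;> ring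
    rw [Finset.sum_congr rfl h2, ← Finset.mul_sum, abs_mul]
    cases b <;> simp

/-- Iterated sparsification. -/
theorem exists_iterated_sparsifier {ι F V : Type*} [Fintype ι] [DecidableEq ι] [Field F]
    [Fintype F] [DecidableEq F] [AddCommGroup V] [Module F V] (v : ι → V) {D : ℕ}
    (hD : ∀ B : Finset ι, LinearIndepOn F v (B : Set ι) → B.card ≤ D) {ε : ℝ} (hε : 0 < ε)
    (hε1 : ε ≤ 1) {t : ℕ} (ht : 0 < t)
    (hsmall : Fintype.card ι * (t * (2 *
      ((1 + Fintype.card F * Real.exp (-(ε ^ 2 * t / 2))) ^ D - 1))) < 1)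
    (J : Finset ι) (w : ι → ℝ) (hw : ∀ j ∈ J, 0 ≤ w j) (k : ℕ) :
    ∃ S ⊆ J, ∃ w' : ι → ℝ, (∀ j ∈ S, 0 ≤ w' j) ∧ 2 ^ k * S.card ≤ 2 ^ k * (t * D) + J.card ∧
      ∀ φ : V →ₗ[F] F,
        (1 - ε) ^ k * ∑ j ∈ J, (w j * if φ (v j) = 0 then 0 else 1) ≤
          ∑ j ∈ S, (w' j * if φ (v j) = 0 then 0 else 1) ∧
        ∑ j ∈ S, (w' j * if φ (v j) = 0 then 0 else 1) ≤
          (1 + ε) ^ k * ∑ j ∈ J, (w j * if φ (v j) = 0 then 0 else 1) := by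
  induction k with
  | zero => exact ⟨J, subset_rfl, w, hw, by simp, fun φ => by simp⟩
  | succ k ih =>
    obtain ⟨S, hSJ, w₁, hw₁, hcard, happ⟩ := ih
    obtain ⟨S', hS', w₂, hw₂, hcard', happ'⟩ := exists_half_sparsifier v hD hε ht hsmall S w₁ hw₁
    refine ⟨S', hS'.trans hSJ, w₂, hw₂, ?_, fun φ => ?_⟩
    · have := Nat.mul_le_mul_left (2 ^ k) hcard'
      rw [pow_succ]
      nlinarith
    · obtain ⟨h1, h2⟩ := happ φ
      obtain ⟨h3, h4⟩ := abs_le.1 (happ' φ)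
      have h5 := mul_le_mul_of_nonneg_left h1 (sub_nonneg.2 hε1)
      have h6 := mul_le_mul_of_nonneg_left h2 (by linarith : 0 ≤ 1 + ε)
      rw [pow_succ', pow_succ', mul_assoc, mul_assoc]
      constructor <;> linarith

/-- A set with at least two elements supports a nowhere vanishing `ZMod 3`-vector of sum zero. -/
theorem exists_support_eq_sum_eq_zero {α : Type*} [DecidableEq α] (A : Finset α)
    (hA : 1 < A.card) : ∃ u : α → ZMod 3, (∀ x, u x ≠ 0 ↔ x ∈ A) ∧ ∑ x ∈ A, u x = 0 := by
  obtain ⟨x, hx, y, hy, hxy⟩ := Finset.one_lt_card.1 hA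
  have hsolve : ∀ s : ZMod 3, ∃ a b : ZMod 3, a ≠ 0 ∧ b ≠ 0 ∧ a + (b + s) = 0 := by decide
  obtain ⟨a, b, ha, hb, hab⟩ := hsolve (∑ z ∈ (A.erase x).erase y, 1)
  refine ⟨fun z => if z = x then a else if z = y then b else if z ∈ A then 1 else 0, ?_, ?_⟩
  · intro z
    by_cases hzx : z = x
    · simp [hzx, ha, hx]
    by_cases hzy : z = y
    · subst hzy
      simp [hzx, hb, hy]
    by_cases hz : z ∈ A <;> simp [hzx, hzy, hz]
  · have hy' : y ∈ A.erase x := Finset.mem_erase.2 ⟨hxy.symm, hy⟩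
    rw [← Finset.add_sum_erase _ _ hx, ← Finset.add_sum_erase _ _ hy', if_pos rfl,
      if_neg hxy.symm, if_pos rfl, ← hab]
    congr 2
    refine Finset.sum_congr rfl fun z hz => ?_
    have hz1 := Finset.mem_erase.1 hz
    have hz2 := Finset.mem_erase.1 hz1.2
    rw [if_neg hz2.1, if_neg hz1.1, if_pos hz2.2]

/-- The indicator, as a function of the assignment, of the variables `τ` taking the values `y`. -/
def patternIndicator (F : Type*) [Field F] {n k : ℕ} (τ : Fin k → Fin n) (y : Fin k → Bool) :
    (Fin n → Bool) → F :=
  fun a => if (fun l => a (τ l)) = y then 1 else 0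

/-- Modulo indicators on one variable fewer, flipping a coordinate negates an indicator. -/
theorem patternIndicator_update_add {F : Type*} [Field F] {n k : ℕ} (τ : Fin (k + 1) → Fin n)
    (y : Fin (k + 1) → Bool) (i : Fin (k + 1)) :
    patternIndicator F τ (Function.update y i true) +
      patternIndicator F τ (Function.update y i false) =
      patternIndicator F (fun l => τ (i.succAbove l)) (fun l => y (i.succAbove l)) := by
  funext a
  have h : ∀ b : Bool, (fun l => a (τ l)) = Function.update y i b ↔
      a (τ i) = b ∧ (fun l => a (τ (i.succAbove l))) = fun l => y (i.succAbove l) := by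
    intro b
    rw [Function.eq_update_iff, funext_iff]
    refine and_congr_right fun _ => ⟨fun h l => h _ (Fin.succAbove_ne i l), fun h l hl => ?_⟩
    obtain ⟨m, rfl⟩ := Fin.exists_succAbove_eq hl
    exact h m
  simp only [Pi.add_apply, patternIndicator, h]
  by_cases h2 : (fun l => a (τ (i.succAbove l))) = fun l => y (i.succAbove l) <;>
    cases a (τ i) <;> simp [h2]

/-- A function of `k + 1` Boolean variables whose signed sum vanishes is a combination of
indicators in `k` variables. -/
theorem comp_mem_span_patternIndicator {F : Type*} [Field F] {n k : ℕ} (τ : Fin (k + 1) → Fin n)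
    (g : (Fin (k + 1) → Bool) → F)
    (hg : ∑ y, g y * (-1) ^ (Finset.univ.filter fun l => y l = true).card = 0) :
    (fun a : Fin n → Bool => g fun l => a (τ l)) ∈ Submodule.span F
      (Set.range fun p : (Fin k → Fin n) × (Fin k → Bool) => patternIndicator F p.1 p.2) := by
  set W := Submodule.span F
      (Set.range fun p : (Fin k → Fin n) × (Fin k → Bool) => patternIndicator F p.1 p.2)
  have hflip : ∀ y i, W.mkQ (patternIndicator F τ (Function.update y i true)) =
      -W.mkQ (patternIndicator F τ (Function.update y i false)) := by
    intro y i
    rw [eq_neg_iff_add_eq_zero, ← map_add, patternIndicator_update_add, Submodule.mkQ_apply,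
      Submodule.Quotient.mk_eq_zero]
    exact Submodule.subset_span ⟨(_, _), rfl⟩
  have hset : ∀ s : Finset (Fin (k + 1)), W.mkQ (patternIndicator F τ fun l => decide (l ∈ s)) =
      (-1 : F) ^ s.card • W.mkQ (patternIndicator F τ fun _ => false) := by
    intro s
    induction s using Finset.induction_on with
    | empty => simp
    | insert i s hi ih =>
      have h1 : (fun l => decide (l ∈ insert i s)) =
          Function.update (fun l => decide (l ∈ s)) i true := by
        funext l
        by_cases h : l = i
        · subst h; simp
        · simp [h]
      have h2 : (fun l => decide (l ∈ s)) =
          Function.update (fun l => decide (l ∈ s)) i false := by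
        rw [eq_comm, Function.update_eq_self_iff]
        simp [hi]
      rw [h1, hflip, ← h2, ih, Finset.card_insert_of_notMem hi, pow_succ, mul_neg_one, neg_smul]
  have hy : ∀ y : Fin (k + 1) → Bool, W.mkQ (patternIndicator F τ y) =
      (-1 : F) ^ (Finset.univ.filter fun l => y l = true).card •
        W.mkQ (patternIndicator F τ fun _ => false) := by
    intro y
    have h := hset (Finset.univ.filter fun l => y l = true)
    simpa only [Finset.mem_filter, Finset.mem_univ, true_and, Bool.decide_eq_true] using h
  have hsum : (fun a : Fin n → Bool => g fun l => a (τ l)) =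
      ∑ y, g y • patternIndicator F τ y := by
    funext a
    simp [patternIndicator, Finset.sum_apply]
  rw [hsum, ← Submodule.Quotient.mk_eq_zero, ← Submodule.mkQ_apply, map_sum]
  have hterm : ∀ y, W.mkQ (g y • patternIndicator F τ y) =
      (g y * (-1) ^ (Finset.univ.filter fun l => y l = true).card) •
        W.mkQ (patternIndicator F τ fun _ => false) := by
    intro y
    rw [map_smul, hy, smul_smul]
  rw [Finset.sum_congr rfl fun y _ => hterm y, ← Finset.sum_smul, hg, zero_smul]

/-- Linearly independent families in the span of `N` vectors have at most `N` members. -/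
theorem card_le_of_linearIndepOn_of_mem_span {ι κ F V : Type*} [Fintype κ] [Field F]
    [AddCommGroup V] [Module F V] (v : ι → V) (b : κ → V)
    (h : ∀ i, v i ∈ Submodule.span F (Set.range b)) (B : Finset ι)
    (hB : LinearIndepOn F v (B : Set ι)) : B.card ≤ Fintype.card κ := by
  have : Fintype (Set.range b) := Fintype.ofFinite _
  have h1 := linearIndependent_le_span' (fun i : (B : Set ι) => v i) hB (Set.range b) (by
    rintro _ ⟨i, rfl⟩
    exact h i)
  have h2 : Fintype.card (Set.range b) ≤ Fintype.card κ := by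
    classical
    exact Fintype.card_range_le b
  rw [Cardinal.mk_fintype, Nat.cast_le] at h1
  simpa using h1.trans h2

/-- Sparsification of a CSP by a linear sparsification step repeated `k` times. -/
theorem exists_csp_sparsifier {r n m : ℕ} (P : (Fin (r + 1) → Bool) → Bool)
    (hP : 1 < (Finset.univ.filter fun x : Fin (r + 1) → Bool => P x = true).card)
    {ε : ℝ} (hε : 0 < ε) (hε1 : ε ≤ 1) {t : ℕ} (ht : 0 < t)
    (hsmall : (n : ℝ) ^ (r + 1) * (t * (2 *
      ((1 + 3 * Real.exp (-(ε ^ 2 * t / 2))) ^ (n ^ r * 2 ^ r) - 1))) < 1)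
    (w : Fin m → ℝ) (τ : Fin m → Fin (r + 1) → Fin n) (hw : ∀ j, 0 ≤ w j) (k : ℕ) :
    ∃ (S : Finset (Fin m)) (w' : Fin m → ℝ), (∀ j ∈ S, 0 ≤ w' j) ∧
      2 ^ k * S.card ≤ 2 ^ k * (t * (n ^ r * 2 ^ r)) + n ^ (r + 1) ∧
      ∀ a : Fin n → Bool, (1 - ε) ^ k * cspVal P w τ a ≤ cspValOn P S w' τ a ∧
        cspValOn P S w' τ a ≤ (1 + ε) ^ k * cspVal P w τ a := by
  classical
  obtain ⟨u, hu, hu0⟩ := exists_support_eq_sum_eq_zero _ hP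
  let sgn : (Fin (r + 1) → Bool) → ZMod 3 :=
    fun y => (-1) ^ (Finset.univ.filter fun l => y l = true).card
  have hsgn : ∀ y, sgn y * sgn y = 1 := fun y => by simp [sgn, ← mul_pow]
  let g : (Fin (r + 1) → Bool) → ZMod 3 := fun y => u y * sgn y
  have hg : ∀ y, g y = 0 ↔ ¬ P y = true := by
    intro y
    have h1 : sgn y ≠ 0 := fun h => by simpa [h] using hsgn y
    have h2 := hu y
    simp only [Finset.mem_filter, Finset.mem_univ, true_and] at h2
    rw [← h2, not_not]
    simp [g, h1]
  have hg0 : ∑ y, g y * (-1) ^ (Finset.univ.filter fun l => y l = true).card = 0 := by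
    have h1 : ∀ y, g y * (-1) ^ (Finset.univ.filter fun l => y l = true).card = u y := by
      intro y
      change u y * sgn y * sgn y = u y
      rw [mul_assoc, hsgn, mul_one]
    rw [Finset.sum_congr rfl fun y _ => h1 y, ← hu0]
    refine (Finset.sum_subset (Finset.subset_univ _) fun y _ hy => ?_).symm
    by_contra h
    exact hy ((hu y).1 h)
  let v : (Fin (r + 1) → Fin n) → ((Fin n → Bool) → ZMod 3) := fun τ a => g fun l => a (τ l)
  have hD : ∀ B : Finset (Fin (r + 1) → Fin n), LinearIndepOn (ZMod 3) v (B : Set _) →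
      B.card ≤ n ^ r * 2 ^ r := by
    intro B hB
    simpa using card_le_of_linearIndepOn_of_mem_span v _
      (fun τ => comp_mem_span_patternIndicator τ g hg0) B hB
  let W : (Fin (r + 1) → Fin n) → ℝ := fun ρ => ∑ j with τ j = ρ, w j
  obtain ⟨S, hSJ, w', hw', hcard, happ⟩ := exists_iterated_sparsifier v hD hε hε1 ht
    (by simpa [ZMod.card] using hsmall) (Finset.univ.image τ) W
    (fun ρ _ => Finset.sum_nonneg fun j _ => hw j) k
  obtain ⟨U, -, hinj, rfl⟩ := Finset.exists_subset_injOn_image_eq_of_surjOn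
    (f := τ) Set.univ S fun ρ hρ => by simpa using hSJ hρ
  refine ⟨U, fun j => w' (τ j), fun j hj => hw' _ (Finset.mem_image_of_mem τ hj), ?_,
    fun a => ?_⟩
  · rw [Finset.card_image_of_injOn hinj] at hcard
    have h1 : (Finset.univ.image τ).card ≤ n ^ (r + 1) := by
      simpa using Finset.card_le_univ (Finset.univ.image τ)
    omega
  · have h1 := happ (LinearMap.proj a)
    have hval : ∀ ρ, (if (LinearMap.proj a : ((Fin n → Bool) → ZMod 3) →ₗ[ZMod 3] ZMod 3) (v ρ) = 0
        then (0 : ℝ) else 1) = if P (fun l => a (ρ l)) then 1 else 0 := by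
      intro ρ
      have := hg fun l => a (ρ l)
      simp only [LinearMap.proj_apply, v, this]
      by_cases h : P (fun l => a (ρ l)) = true <;> simp [h]
    simp only [hval] at h1
    have hfull : cspVal P w τ a =
        ∑ ρ ∈ Finset.univ.image τ, W ρ * if P (fun l => a (ρ l)) then 1 else 0 := by
      rw [cspVal, ← Finset.sum_fiberwise_of_maps_to
        (fun j _ => Finset.mem_image_of_mem τ (Finset.mem_univ j))]
      refine Finset.sum_congr rfl fun ρ _ => ?_
      rw [Finset.sum_mul]
      refine Finset.sum_congr rfl fun j hj => ?_
      rw [(Finset.mem_filter.1 hj).2]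
    have hsub : cspValOn P U (fun j => w' (τ j)) τ a =
        ∑ ρ ∈ U.image τ, w' ρ * if P (fun l => a (ρ l)) then 1 else 0 := by
      rw [cspValOn, Finset.sum_image hinj]
    rw [hfull, hsub]
    exact h1

/-- The failure probability of one step is below one as soon as `t` is logarithmically large. -/
theorem failure_bound_lt_one {N : ℝ} (hN : 1 ≤ N) {D : ℕ} (hD : 1 ≤ D) {δ : ℝ} (hδ : 0 < δ)
    (hδ1 : δ ≤ 1) {t : ℕ} (ht : 4 / δ ^ 2 * Real.log (49 * N * D / δ ^ 2) ≤ t) :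
    N * (t * (2 * ((1 + 3 * Real.exp (-(δ ^ 2 * t / 2))) ^ D - 1))) < 1 := by
  have hD' : (1 : ℝ) ≤ D := by exact_mod_cast hD
  have hδ2 : 0 < δ ^ 2 := by positivity
  have hδ3 : δ ^ 2 ≤ 1 := pow_le_one₀ hδ.le hδ1
  set u := Real.exp (-(δ ^ 2 * t / 4)) with hu
  have hupos : 0 < u := Real.exp_pos _
  have hq : Real.exp (-(δ ^ 2 * t / 2)) = u * u := by
    rw [hu, ← Real.exp_add]; congr 1; ring
  have hinv : Real.exp (δ ^ 2 * t / 4) * u = 1 := by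
    rw [hu, ← Real.exp_add]; simp
  have hbig : 49 * N * D / δ ^ 2 ≤ Real.exp (δ ^ 2 * t / 4) := by
    rw [← Real.log_le_iff_le_exp (by positivity)]
    rw [div_mul_eq_mul_div, div_le_iff₀ hδ2] at ht
    linarith
  have hND : 49 * N * D * u ≤ δ ^ 2 := by
    have h := mul_le_mul_of_nonneg_right hbig hupos.le
    rw [hinv, div_mul_eq_mul_div, div_le_one hδ2] at h
    exact h
  have htu : δ ^ 2 * t * u ≤ 4 := by
    have h1 : δ ^ 2 * t / 4 ≤ Real.exp (δ ^ 2 * t / 4) := by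
      linarith [Real.add_one_le_exp (δ ^ 2 * t / 4)]
    have h := mul_le_mul_of_nonneg_right h1 hupos.le
    rw [hinv] at h
    linarith
  have hDu : 49 * (D * u) ≤ 1 := by
    have : D * u ≤ N * (D * u) := le_mul_of_one_le_left (by positivity) hN
    linarith
  have hu1 : u ≤ 1 := by
    have : u ≤ D * u := le_mul_of_one_le_left hupos.le hD'
    linarith
  have hx1 : D * (3 * (u * u)) ≤ 1 := by
    have := mul_le_mul hDu hu1 hupos.le zero_le_one
    linarith
  have hpow : (1 + 3 * (u * u)) ^ D - 1 ≤ 2 * (D * (3 * (u * u))) := by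
    have h1 : (1 + 3 * (u * u)) ^ D ≤ Real.exp (D * (3 * (u * u))) := by
      rw [Real.exp_nat_mul]
      refine pow_le_pow_left₀ (by positivity) ?_ _
      linarith [Real.add_one_le_exp (3 * (u * u))]
    have h2 := Real.abs_exp_sub_one_le (x := D * (3 * (u * u))) (by
      rwa [abs_of_nonneg (by positivity)])
    rw [abs_of_nonneg (by positivity : (0 : ℝ) ≤ D * (3 * (u * u)))] at h2
    linarith [le_abs_self (Real.exp (D * (3 * (u * u))) - 1)]
  rw [hq]
  have h1 : N * (t * (2 * ((1 + 3 * (u * u)) ^ D - 1))) ≤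
      N * (t * (2 * (2 * (D * (3 * (u * u)))))) := by
    gcongr
  have h2 : δ ^ 2 * (N * (t * (2 * (2 * (D * (3 * (u * u))))))) ≤ 48 * (N * D * u) := by
    have h3 : 0 ≤ 12 * (N * D * u) := by positivity
    have := mul_le_mul_of_nonneg_right htu h3
    linarith
  have h4 : δ ^ 2 * (N * (t * (2 * (2 * (D * (3 * (u * u))))))) < δ ^ 2 * 1 := by
    nlinarith
  exact h1.trans_lt (lt_of_mul_lt_mul_left h4 hδ2.le)

/-- Choice of the number of halving steps and of the number of packed independent sets. -/
theorem exists_parameters (r : ℕ) : ∃ K : ℝ, 0 < K ∧ ∀ (n : ℕ) (ε : ℝ), 1 ≤ n → 0 < ε → ε < 1 →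
    ∃ k t : ℕ, 0 < k ∧ 0 < t ∧ n ^ (r + 1) ≤ 2 ^ k ∧
      (n : ℝ) ^ (r + 1) * (t * (2 *
        ((1 + 3 * Real.exp (-((ε / (2 * k)) ^ 2 * t / 2))) ^ (n ^ r * 2 ^ r) - 1))) < 1 ∧
      (t : ℝ) * (n ^ r * 2 ^ r) + 1 ≤
        K * (n : ℝ) ^ r * Real.logb 2 (2 * n / ε) ^ 3 / ε ^ 2 := by
  set R : ℝ := r + 1 with hR
  have hR1 : 1 ≤ R := by simp [hR]
  set C : ℝ := 196 * R ^ 2 + (2 * r + 5) with hC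
  have hC0 : 0 < C := by positivity
  refine ⟨(16 * R ^ 2 * C + 1) * 2 ^ r + 1, by positivity, fun n ε hn hε hε1 => ?_⟩
  have hn' : (1 : ℝ) ≤ n := by exact_mod_cast hn
  set X : ℝ := 2 * n / ε with hX
  have hX2 : 2 * (n : ℝ) ≤ X := by
    rw [hX, le_div_iff₀ hε]; nlinarith
  have hXpos : 0 < X := by linarith
  have hXε : 1 / ε ≤ X := by
    rw [hX]; gcongr; linarith
  set L := Real.logb 2 X with hL
  have hlogX : Real.log X ≤ L := by
    have h : Real.log X = L * Real.log 2 := by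
      rw [hL, Real.logb, div_mul_cancel₀ _ (Real.log_pos (by norm_num)).ne']
    have h1 : 0 ≤ L := Real.logb_nonneg (by norm_num) (by linarith)
    have h2 : Real.log 2 ≤ 1 := by linarith [Real.log_two_lt_d9]
    rw [h]; nlinarith
  have hlogn : ((Nat.log 2 n + 1 : ℕ) : ℝ) ≤ L := by
    rw [hL, Real.le_logb_iff_rpow_le (by norm_num) hXpos, Real.rpow_natCast]
    have : (2 : ℝ) ^ Nat.log 2 n ≤ n := by exact_mod_cast Nat.pow_log_le_self 2 (by omega)
    rw [pow_succ]; linarith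
  have hL1 : 1 ≤ L := le_trans (by exact_mod_cast Nat.le_add_left 1 _) hlogn
  have hLX : L ≤ X := by
    rw [hL, Real.logb, div_le_iff₀ (Real.log_pos (by norm_num))]
    have h0 : 1 / 2 ≤ Real.log 2 := by linarith [Real.log_two_gt_d9]
    have h1 := Real.log_le_sub_one_of_pos (by positivity : 0 < X / 2)
    rw [Real.log_div hXpos.ne' two_ne_zero] at h1
    nlinarith [Real.log_two_lt_d9]
  set k := (r + 1) * (Nat.log 2 n + 1) with hk
  have hkL : (k : ℝ) ≤ R * L := by
    rw [hk, Nat.cast_mul, hR]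
    push_cast at hlogn ⊢
    gcongr
  have hk0 : 0 < k := by positivity
  have hk1 : (1 : ℝ) ≤ k := by exact_mod_cast hk0
  set δ := ε / (2 * k) with hδ
  have hδ0 : 0 < δ := by positivity
  have hδ1 : δ ≤ 1 := by
    rw [hδ, div_le_one (by positivity)]; linarith
  have hA : 1 / δ ^ 2 ≤ 4 * R ^ 2 * L ^ 2 / ε ^ 2 := by
    have : 1 / δ ^ 2 = 4 * (k : ℝ) ^ 2 / ε ^ 2 := by
      rw [hδ]; field_simp; ring
    rw [this]
    have hkRL : (k : ℝ) ^ 2 ≤ (R * L) ^ 2 := by gcongr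
    exact div_le_div_of_nonneg_right (by linarith [mul_pow R L 2]) (by positivity)
  have hlog : Real.log (49 * (n : ℝ) ^ (r + 1) * (n ^ r * 2 ^ r : ℕ) / δ ^ 2) ≤ C * L := by
    have h1 : 49 * (n : ℝ) ^ (r + 1) * (n ^ r * 2 ^ r : ℕ) / δ ^ 2 ≤
        196 * R ^ 2 * X ^ (2 * r + 5) := by
      have e1 : (n : ℝ) ^ (r + 1) ≤ X ^ (r + 1) := by gcongr; linarith
      have e2 : ((n ^ r * 2 ^ r : ℕ) : ℝ) ≤ X ^ r := by
        push_cast; rw [← mul_pow]; gcongr; linarith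
      have e3 : 1 / δ ^ 2 ≤ 4 * R ^ 2 * X ^ 2 * X ^ 2 := by
        refine hA.trans ?_
        have : 4 * R ^ 2 * L ^ 2 / ε ^ 2 = 4 * R ^ 2 * L ^ 2 * (1 / ε) ^ 2 := by
          rw [one_div, inv_pow]; rfl
        rw [this]
        gcongr
      calc _ = 49 * (n : ℝ) ^ (r + 1) * (n ^ r * 2 ^ r : ℕ) * (1 / δ ^ 2) := by ring
        _ ≤ 49 * X ^ (r + 1) * X ^ r * (4 * R ^ 2 * X ^ 2 * X ^ 2) := by gcongr
        _ = _ := by ring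
    have h0 : 0 < 49 * (n : ℝ) ^ (r + 1) * (n ^ r * 2 ^ r : ℕ) / δ ^ 2 := by positivity
    refine (Real.log_le_log h0 h1).trans ?_
    rw [Real.log_mul (by positivity) (by positivity), Real.log_pow, hC, add_mul]
    have h2 : Real.log (196 * R ^ 2) ≤ 196 * R ^ 2 := by
      linarith [Real.log_le_sub_one_of_pos (by positivity : 0 < 196 * R ^ 2)]
    have h3 : 196 * R ^ 2 ≤ 196 * R ^ 2 * L := le_mul_of_one_le_right (by positivity) hL1
    push_cast
    gcongr
    exact h2.trans h3
  set T : ℝ := 4 / δ ^ 2 * (C * L) with hT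
  have hTpos : 0 < T := by positivity
  refine ⟨k, ⌈T⌉₊, hk0, Nat.ceil_pos.2 hTpos, ?_, ?_, ?_⟩
  · rw [hk, mul_comm, pow_mul]
    exact Nat.pow_le_pow_left (Nat.lt_pow_succ_log_self (by norm_num) n).le _
  · refine failure_bound_lt_one (one_le_pow₀ hn') (Nat.one_le_iff_ne_zero.2 (by positivity))
      hδ0 hδ1 ((mul_le_mul_of_nonneg_left hlog (by positivity)).trans (Nat.le_ceil T))
  · have hQ1 : 1 ≤ L ^ 3 / ε ^ 2 := by
      rw [le_div_iff₀ (by positivity), one_mul]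
      exact (pow_le_one₀ hε.le hε1.le).trans (one_le_pow₀ hL1)
    have hTle : T ≤ 16 * R ^ 2 * C * (L ^ 3 / ε ^ 2) := by
      calc T = 4 * (C * L) * (1 / δ ^ 2) := by rw [hT]; ring
        _ ≤ 4 * (C * L) * (4 * R ^ 2 * L ^ 2 / ε ^ 2) := by gcongr
        _ = _ := by ring
    have hceil : (⌈T⌉₊ : ℝ) ≤ (16 * R ^ 2 * C + 1) * (L ^ 3 / ε ^ 2) := by
      linarith [Nat.ceil_lt_add_one hTpos.le]
    have hnr : (1 : ℝ) ≤ n ^ r := one_le_pow₀ hn'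
    calc (⌈T⌉₊ : ℝ) * (n ^ r * 2 ^ r) + 1 ≤
          (16 * R ^ 2 * C + 1) * (L ^ 3 / ε ^ 2) * (n ^ r * 2 ^ r) + n ^ r * (L ^ 3 / ε ^ 2) := by
          gcongr
          nlinarith
      _ = _ := by ring

/-- every predicate with a number of satisfying assignments ≠ 1 admits
sparsifiers of size roughly n^{r−1}. -/
theorem stmt_15 (r : ℕ) (hr : 1 ≤ r) :
    ∃ K c : ℝ, 0 < K ∧ 0 < c ∧
      ∀ P : (Fin r → Bool) → Bool,
        (Finset.univ.filter fun x : Fin r → Bool => P x = true).card ≠ 1 →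
      ∀ ε : ℝ, 0 < ε → ε < 1 → ∀ n : ℕ, 1 ≤ n →
      ∀ (m : ℕ) (w : Fin m → ℝ) (t : Fin m → Fin r → Fin n), (∀ j, 0 ≤ w j) →
      ∃ (S : Finset (Fin m)) (w' : Fin m → ℝ),
        (∀ j ∈ S, 0 ≤ w' j) ∧
        (S.card : ℝ) ≤ K * (n : ℝ) ^ (r - 1) *
          (Real.logb 2 (2 * (n : ℝ) / ε)) ^ c / ε ^ 2 ∧
        ∀ a : Fin n → Bool,
          (1 - ε) * cspVal P w t a ≤ cspValOn P S w' t a ∧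
          cspValOn P S w' t a ≤ (1 + ε) * cspVal P w t a := by
  obtain ⟨r, rfl⟩ : ∃ q, r = q + 1 := ⟨r - 1, by omega⟩
  obtain ⟨K, hK, hpar⟩ := exists_parameters r
  refine ⟨K, 3, hK, by norm_num, fun P hP ε hε hε1 n hn m w τ hw => ?_⟩
  obtain ⟨k, t, hk, ht, hnk, hsmall, hbound⟩ := hpar n ε hn hε hε1
  rcases Nat.lt_or_ge 1 (Finset.univ.filter fun x : Fin (r + 1) → Bool => P x = true).card with
    hP2 | hP0
  · have hk1 : (1 : ℝ) ≤ k := by exact_mod_cast hk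
    have hδ1 : ε / (2 * k) ≤ 1 := by rw [div_le_one (by positivity)]; linarith
    have hkδ : (k : ℝ) * (ε / (2 * k)) = ε / 2 := by field_simp
    obtain ⟨S, w', hw', hcard, happ⟩ :=
      exists_csp_sparsifier P hP2 (by positivity) hδ1 ht hsmall w τ hw k
    refine ⟨S, w', hw', ?_, fun a => ?_⟩
    · have h1 : S.card ≤ t * (n ^ r * 2 ^ r) + 1 := by
        refine Nat.le_of_mul_le_mul_left (hcard.trans ?_) (pow_pos two_pos k)
        rw [mul_add, mul_one]
        omega
      have h2 : (S.card : ℝ) ≤ t * (n ^ r * 2 ^ r) + 1 := by exact_mod_cast h1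
      rw [Nat.add_sub_cancel, Real.rpow_ofNat]
      exact h2.trans hbound
    · obtain ⟨h1, h2⟩ := happ a
      have hval : 0 ≤ cspVal P w τ a := Finset.sum_nonneg fun j _ =>
        mul_nonneg (hw j) (by split_ifs <;> norm_num)
      have hlo : 1 - ε ≤ (1 - ε / (2 * k)) ^ k := by
        have := one_add_mul_le_pow (a := -(ε / (2 * k))) (by linarith) k
        rw [← sub_eq_add_neg] at this
        linarith
      have hhi : (1 + ε / (2 * k)) ^ k ≤ 1 + ε := by
        have e1 : (1 + ε / (2 * k)) ^ k ≤ Real.exp (ε / 2) := by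
          rw [← hkδ, Real.exp_nat_mul]
          refine pow_le_pow_left₀ (by positivity) ?_ _
          linarith [Real.add_one_le_exp (ε / (2 * k))]
        have e2 := Real.abs_exp_sub_one_le (x := ε / 2) (by
          rw [abs_of_nonneg (by positivity)]; linarith)
        rw [abs_of_nonneg (by positivity : 0 ≤ ε / 2)] at e2
        linarith [le_abs_self (Real.exp (ε / 2) - 1)]
      exact ⟨(mul_le_mul_of_nonneg_right hlo hval).trans h1,
        h2.trans (mul_le_mul_of_nonneg_right hhi hval)⟩
  · have hP1 : (Finset.univ.filter fun x : Fin (r + 1) → Bool => P x = true).card = 0 := by omega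
    have hfalse : ∀ x, ¬ P x = true := by
      simpa [Finset.filter_eq_empty_iff] using hP1
    refine ⟨∅, fun _ => 0, by simp, ?_, fun a => by simp [cspVal, cspValOn, hfalse]⟩
    rw [Nat.add_sub_cancel, Real.rpow_ofNat, Finset.card_empty, Nat.cast_zero]
    refine le_trans ?_ hbound
    positivity
end

section
/- Let r ≥ 1, let P : {0,1}^r → {0,1} be the AND predicate (P(x) = 1 if and only if x₁ = ⋯ = x_r = 1), let ε ∈ (0,1), and let n ≥ r. Let Φ be the instance of CSP(P) on n variables consisting of one constraint of weight 1 for each r-element subset of the n variables (with the variables of each constraint listed in increasing order). Then every (ε, s)-sparsifier of Φ satisfies s ≥ C(n, r), the binomial coefficient; that is, every sparsifier must retain all constraints of Φ. -/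
/-- The AND constraint on `e` is satisfied by the indicator of a set `T` of the same size
exactly when `e = T`. -/
lemma and_indicator_iff {r n : ℕ} {P : (Fin r → Bool) → Bool}
    (hP : ∀ x : Fin r → Bool, P x = true ↔ ∀ k, x k = true)
    (e T : {s : Finset (Fin n) // s.card = r}) :
    P (fun k => decide ((e.1.orderIsoOfFin e.2 k : Fin n) ∈ T.1)) = true ↔ e = T := by
  simp only [hP, decide_eq_true_eq]
  refine ⟨fun h => Subtype.ext (Finset.eq_of_subset_of_card_le (fun x hx => ?_)
    (T.2.trans e.2.symm).le), ?_⟩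
  · simpa using h ((e.1.orderIsoOfFin e.2).symm ⟨x, hx⟩)
  · rintro rfl k
    exact (e.1.orderIsoOfFin e.2 k).2


/-- for the AND predicate and the instance consisting of one
weight-1 constraint per r-element subset of the n variables (in increasing order),
every (ε, s)-sparsifier must retain all C(n, r) constraints. -/
theorem stmt_16 (r n : ℕ) (hr : 1 ≤ r) (hn : r ≤ n) (ε : ℝ) (hε : 0 < ε) (hε1 : ε < 1)
    (P : (Fin r → Bool) → Bool) (hP : ∀ x : Fin r → Bool, P x = true ↔ ∀ k, x k = true)
    (S : Finset {s : Finset (Fin n) // s.card = r})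
    (w' : {s : Finset (Fin n) // s.card = r} → ℝ)
    (hw' : ∀ e ∈ S, 0 ≤ w' e)
    (hspars : ∀ a : Fin n → Bool,
      (1 - ε) * (∑ e : {s : Finset (Fin n) // s.card = r},
          (1 : ℝ) * (if P (fun k => a ((e.1.orderIsoOfFin e.2 k : Fin n))) then 1 else 0)) ≤
        (∑ e ∈ S, w' e *
          (if P (fun k => a ((e.1.orderIsoOfFin e.2 k : Fin n))) then 1 else 0)) ∧
      (∑ e ∈ S, w' e *
          (if P (fun k => a ((e.1.orderIsoOfFin e.2 k : Fin n))) then 1 else 0)) ≤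
        (1 + ε) * (∑ e : {s : Finset (Fin n) // s.card = r},
          (1 : ℝ) * (if P (fun k => a ((e.1.orderIsoOfFin e.2 k : Fin n))) then 1 else 0))) :
    Nat.choose n r ≤ S.card := by
  have hS : S = Finset.univ := by
    refine Finset.eq_univ_iff_forall.2 fun T => ?_
    by_contra hT
    have h := (hspars fun i => decide (i ∈ T.1)).1
    simp only [and_indicator_iff hP] at h
    simp [hT] at h
    linarith
  simp [hS, Fintype.card_finset_len]
end

section
/- For every additive Abelian group A and all elements a, b, c ∈ A, it is not the case that for every integer k with 0 ≤ k ≤ 20: C(k,2)·a + k·b + c = 0 holds if and only if k ≡ 0 (mod 6) or k ≡ 1 (mod 6). (Equivalently: no symmetric degree-2 polynomial over any Abelian group in 20 Boolean variables vanishes exactly on those inputs whose Hamming weight is congruent to 0 or 1 modulo 6.) -/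
/-- no symmetric degree-2 polynomial over any Abelian group (in 20
Boolean variables) vanishes exactly on the inputs whose Hamming weight is congruent
to 0 or 1 modulo 6. -/
theorem stmt_17 (A : Type) [AddCommGroup A] (a b c : A) :
    ¬ (∀ k : ℕ, k ≤ 20 →
        ((Nat.choose k 2) • a + k • b + c = 0 ↔ (k % 6 = 0 ∨ k % 6 = 1))) := by
  intro h
  have hc : c = 0 := by simpa using (h 0 (by norm_num)).2 (by norm_num)
  have hb : b = 0 := by simpa [hc] using (h 1 (by norm_num)).2 (by norm_num)
  subst hc hb
  have h6 : (15 : ℕ) • a = 0 := by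
    simpa [Nat.choose] using (h 6 (by norm_num)).2 (by norm_num)
  have h7 : (21 : ℕ) • a = 0 := by
    simpa [Nat.choose] using (h 7 (by norm_num)).2 (by norm_num)
  have h3 : (3 : ℕ) • a = 0 := by
    have e : (3 : ℕ) • a = 3 • ((15 : ℕ) • a) - 2 • ((21 : ℕ) • a) := by abel
    rw [e, h6, h7]
    simp
  have := (h 3 (by norm_num)).1 (by simpa [Nat.choose] using h3)
  omega
end
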